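/- Let R and B be disjoint finite sets of points in the plane with |R| = n and |B| = n or |B| = n - 1, where n ≥ 1. If the set P = R ∪ B is neither collinear nor a near-pencil, then P determines at least |P| - 1 bichromatic lines. -/

import Mathlib

open scoped Classical

noncomputable section

/-- A line in the plane: the affine span of two distinct points. -/
def IsLine (L : Set (ℝ × ℝ)) : Prop :=
  ∃ p q : ℝ × ℝ, p ≠ q ∧ L = (affineSpan ℝ ({p, q} : Set (ℝ × ℝ)) : Set (ℝ × ℝ))

/-- The points of the finite set `P` lying on `L`. -/
def ptsOn (P : Finset (ℝ × ℝ)) (L : Set (ℝ × ℝ)) : Finset (ℝ × ℝ) :=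
  P.filter (fun x => x ∈ L)

/-- A line determined by `P`: contains at least two points of `P`. -/
def DeterminedLine (P : Finset (ℝ × ℝ)) (L : Set (ℝ × ℝ)) : Prop :=
  IsLine L ∧ 2 ≤ (ptsOn P L).card

/-- A bichromatic line: determined by `R ∪ B`, with at least one red and one blue point. -/
def BichromaticLine (R B : Finset (ℝ × ℝ)) (L : Set (ℝ × ℝ)) : Prop :=
  DeterminedLine (R ∪ B) L ∧ (∃ p ∈ R, p ∈ L) ∧ (∃ p ∈ B, p ∈ L)

/-- The number of bichromatic lines determined by `R ∪ B`. -/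
def nBichromatic (R B : Finset (ℝ × ℝ)) : ℕ :=
  {L : Set (ℝ × ℝ) | BichromaticLine R B L}.ncard

/-- A near-pencil: some line contains all but exactly one of the points of `P`. -/
def NearPencil (P : Finset (ℝ × ℝ)) : Prop :=
  ∃ L : Set (ℝ × ℝ), IsLine L ∧ (ptsOn P L).card = P.card - 1

section LinearSpace

variable {α : Type*} [DecidableEq α]

/-- A finite linear space: `𝓛` is a family of subsets of `P` with at least two points each, such
that any two distinct points of `P` lie on exactly one member of `𝓛`. -/
structure IsLinearSpace (P : Finset α) (𝓛 : Finset (Finset α)) : Prop where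
  subset : ∀ L ∈ 𝓛, L ⊆ P
  two_le : ∀ L ∈ 𝓛, 2 ≤ L.card
  exists_line : ∀ p ∈ P, ∀ q ∈ P, p ≠ q → ∃ L ∈ 𝓛, p ∈ L ∧ q ∈ L
  unique : ∀ L ∈ 𝓛, ∀ M ∈ 𝓛, ∀ p q, p ≠ q → p ∈ L → q ∈ L → p ∈ M → q ∈ M → L = M

/-- The members of `𝓛` that meet both `R` and `B`. -/
def bichromaticMembers (𝓛 : Finset (Finset α)) (R B : Finset α) : Finset (Finset α) :=
  𝓛.filter fun L => (L ∩ R).Nonempty ∧ (L ∩ B).Nonempty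

/-- The bichromatic members of `𝓛` through `q` other than `L`. -/
def otherBichromatic (𝓛 : Finset (Finset α)) (R B L : Finset α) (q : α) : Finset (Finset α) :=
  (bichromaticMembers 𝓛 R B).filter fun M => q ∈ M ∧ M ≠ L

lemma mem_bichromaticMembers {𝓛 : Finset (Finset α)} {R B L : Finset α} :
    L ∈ bichromaticMembers 𝓛 R B ↔ L ∈ 𝓛 ∧ (L ∩ R).Nonempty ∧ (L ∩ B).Nonempty := by
  simp [bichromaticMembers]

lemma bichromaticMembers_comm (𝓛 : Finset (Finset α)) (R B : Finset α) :
    bichromaticMembers 𝓛 R B = bichromaticMembers 𝓛 B R := by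
  ext L; simp only [mem_bichromaticMembers]; tauto

lemma otherBichromatic_comm (𝓛 : Finset (Finset α)) (R B L : Finset α) (q : α) :
    otherBichromatic 𝓛 R B L q = otherBichromatic 𝓛 B R L q := by
  simp only [otherBichromatic, bichromaticMembers_comm 𝓛 R B]

namespace IsLinearSpace

variable {P R B L : Finset α} {𝓛 : Finset (Finset α)}

/-- The members through a point partition every set of other points. -/
lemma sum_card_inter_star (h : IsLinearSpace P 𝓛) {A : Finset α} (hA : A ⊆ P) {q : α}
    (hq : q ∈ P) (hqA : q ∉ A) :
    ∑ L ∈ 𝓛.filter (fun L => q ∈ L), (L ∩ A).card = A.card := by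
  rw [← Finset.card_biUnion]
  · congr 1
    ext a
    simp only [Finset.mem_biUnion, Finset.mem_filter, Finset.mem_inter]
    constructor
    · rintro ⟨L, -, -, ha⟩; exact ha
    · intro ha
      obtain ⟨L, hL, hqL, haL⟩ := h.exists_line q hq a (hA ha) (by rintro rfl; exact hqA ha)
      exact ⟨L, ⟨hL, hqL⟩, haL, ha⟩
  · intro L hL M hM hLM
    simp only [Finset.coe_filter, Set.mem_ofPred_eq] at hL hM
    refine Finset.disjoint_left.2 fun a haL haM => hLM ?_
    simp only [Finset.mem_inter] at haL haM
    exact h.unique L hL.1 M hM.1 q a (by rintro rfl; exact hqA haL.2) hL.2 haL.1 hM.2 haM.1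

lemma sum_sum_inter_comm (C : Finset α) (f : α → Finset α → ℕ) :
    ∑ L ∈ 𝓛, ∑ q ∈ L ∩ C, f q L = ∑ q ∈ C, ∑ L ∈ 𝓛.filter (fun L => q ∈ L), f q L := by
  refine Finset.sum_comm' ?_
  intro L q
  simp only [Finset.mem_inter, Finset.mem_filter]
  tauto

lemma sum_card_mul_card (h : IsLinearSpace P 𝓛) {A C : Finset α} (hA : A ⊆ P) (hC : C ⊆ P)
    (hAC : Disjoint A C) :
    ∑ L ∈ 𝓛, (L ∩ C).card * (L ∩ A).card = C.card * A.card := by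
  calc ∑ L ∈ 𝓛, (L ∩ C).card * (L ∩ A).card
      = ∑ L ∈ 𝓛, ∑ _q ∈ L ∩ C, (L ∩ A).card := by simp
    _ = ∑ q ∈ C, ∑ L ∈ 𝓛.filter (fun L => q ∈ L), (L ∩ A).card :=
        sum_sum_inter_comm C fun _ L => (L ∩ A).card
    _ = ∑ _q ∈ C, A.card := Finset.sum_congr rfl fun q hq =>
        h.sum_card_inter_star hA (hC hq) (Finset.disjoint_right.1 hAC hq)
    _ = C.card * A.card := by simp

lemma sum_card_mul_pred (h : IsLinearSpace P 𝓛) {A : Finset α} (hA : A ⊆ P) :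
    ∑ L ∈ 𝓛, (L ∩ A).card * ((L ∩ A).card - 1) = A.card * (A.card - 1) := by
  calc ∑ L ∈ 𝓛, (L ∩ A).card * ((L ∩ A).card - 1)
      = ∑ L ∈ 𝓛, ∑ q ∈ L ∩ A, (L ∩ A.erase q).card := by
        refine Finset.sum_congr rfl fun L _ => ?_
        rw [Finset.sum_congr rfl (g := fun _ => (L ∩ A).card - 1)]
        · simp
        · intro q hq
          rw [← Finset.erase_eq_of_notMem (s := L ∩ A.erase q) (a := q) (by simp),
            ← Finset.card_erase_of_mem hq]
          congr 1; ext a; simp; tauto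
    _ = ∑ q ∈ A, ∑ L ∈ 𝓛.filter (fun L => q ∈ L), (L ∩ A.erase q).card :=
        sum_sum_inter_comm A fun q L => (L ∩ A.erase q).card
    _ = ∑ _q ∈ A, (A.card - 1) := Finset.sum_congr rfl fun q hq => by
        rw [h.sum_card_inter_star ((Finset.erase_subset _ _).trans hA) (hA hq) (by simp),
          Finset.card_erase_of_mem hq]
    _ = A.card * (A.card - 1) := by simp

lemma card_eq_add (h : IsLinearSpace P 𝓛) (hP : P = R ∪ B) (hRB : Disjoint R B) (hL : L ∈ 𝓛) :
    L.card = (L ∩ R).card + (L ∩ B).card := by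
  rw [← Finset.card_union_of_disjoint
    (hRB.mono Finset.inter_subset_right Finset.inter_subset_right),
    ← Finset.inter_union_distrib_left, ← hP, Finset.inter_eq_left.2 (h.subset L hL)]

/-- Summed over all members, `|L| - (|L ∩ R| - |L ∩ B|)²` depends only on `|R|` and `|B|`. -/
lemma sum_card_sub_sq (h : IsLinearSpace P 𝓛) (hP : P = R ∪ B) (hRB : Disjoint R B) :
    ∑ L ∈ 𝓛, ((L.card : ℤ) - ((L ∩ R).card - (L ∩ B).card : ℤ) ^ 2)
      = (R.card + B.card : ℤ) - (R.card - B.card : ℤ) ^ 2 := by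
  have hRP : R ⊆ P := hP ▸ Finset.subset_union_left
  have hBP : B ⊆ P := hP ▸ Finset.subset_union_right
  have cast (m : ℕ) : ((m * (m - 1) : ℕ) : ℤ) = m * m - m := by
    cases m <;> simp; ring
  have h1 := congrArg (Nat.cast : ℕ → ℤ) (h.sum_card_mul_card hRP hBP hRB)
  have h2 := congrArg (Nat.cast : ℕ → ℤ) (h.sum_card_mul_pred hRP)
  have h3 := congrArg (Nat.cast : ℕ → ℤ) (h.sum_card_mul_pred hBP)
  rw [Nat.cast_sum] at h1 h2 h3
  simp only [cast] at h2 h3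
  push_cast at h1
  have : ∀ L ∈ 𝓛, ((L.card : ℤ) - ((L ∩ R).card - (L ∩ B).card : ℤ) ^ 2)
      = 2 * ((L ∩ B).card * (L ∩ R).card : ℤ)
        - ((L ∩ R).card * (L ∩ R).card - (L ∩ R).card : ℤ)
        - ((L ∩ B).card * (L ∩ B).card - (L ∩ B).card : ℤ) := by
    intro L hL
    rw [h.card_eq_add hP hRB hL]; push_cast; ring
  rw [Finset.sum_congr rfl this, Finset.sum_sub_distrib, Finset.sum_sub_distrib, ← Finset.mul_sum,
    h1, h2, h3]
  ring

/-- Bichromatic members other than `L` through distinct points of `L` are distinct. -/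
lemma card_biUnion_otherBichromatic (h : IsLinearSpace P 𝓛) (hL : L ∈ 𝓛) :
    (L.biUnion (otherBichromatic 𝓛 R B L)).card
      = ∑ q ∈ L, (otherBichromatic 𝓛 R B L q).card := by
  refine Finset.card_biUnion fun p hp q hq hpq => Finset.disjoint_left.2 fun M hM hM' => ?_
  simp only [otherBichromatic, Finset.mem_filter, mem_bichromaticMembers] at hM hM'
  exact hM.2.2 (h.unique M hM.1.1 L hL p q hpq hM.2.1 hM'.2.1 hp hq)

lemma sum_otherBichromatic_le (h : IsLinearSpace P 𝓛) (hL : L ∈ 𝓛) :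
    (if L ∈ bichromaticMembers 𝓛 R B then 1 else 0)
      + ∑ q ∈ L, (otherBichromatic 𝓛 R B L q).card ≤ (bichromaticMembers 𝓛 R B).card := by
  rw [← h.card_biUnion_otherBichromatic hL]
  have hsub : L.biUnion (otherBichromatic 𝓛 R B L) ⊆ (bichromaticMembers 𝓛 R B).erase L := by
    intro M hM
    simp only [Finset.mem_biUnion, otherBichromatic, Finset.mem_filter] at hM
    obtain ⟨q, _, h1, _, h2⟩ := hM
    exact Finset.mem_erase.2 ⟨h2, h1⟩
  have := Finset.card_le_card hsub
  split_ifs with hb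
  · have h2 := Finset.card_erase_add_one hb
    omega
  · rw [Finset.erase_eq_of_notMem hb] at this
    omega

lemma exists_otherBichromatic (h : IsLinearSpace P 𝓛) (hP : P = R ∪ B) {a r : α} (ha : a ∈ B)
    (haL : a ∈ L) (hr : r ∈ R \ L) :
    ∃ M ∈ otherBichromatic 𝓛 R B L a, r ∈ M := by
  rw [Finset.mem_sdiff] at hr
  obtain ⟨M, hM, haM, hrM⟩ := h.exists_line a (hP ▸ Finset.mem_union_right _ ha) r
    (hP ▸ Finset.mem_union_left _ hr.1) (by rintro rfl; exact hr.2 haL)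
  refine ⟨M, ?_, hrM⟩
  simp only [otherBichromatic, Finset.mem_filter, mem_bichromaticMembers]
  exact ⟨⟨hM, ⟨r, by simp [hrM, hr.1]⟩, ⟨a, by simp [haM, ha]⟩⟩, haM,
    by rintro rfl; exact hr.2 hrM⟩

lemma card_sdiff_le_mul (h : IsLinearSpace P 𝓛) (hP : P = R ∪ B) {a b : α}
    (ha : a ∈ L ∩ B) (hb : b ∈ L ∩ B) (hab : a ≠ b) (hL : L ∈ 𝓛) :
    (R \ L).card ≤ (otherBichromatic 𝓛 R B L a).card * (otherBichromatic 𝓛 R B L b).card := by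
  rw [Finset.mem_inter] at ha hb
  choose! f hf hrf using fun r (hr : r ∈ R \ L) => h.exists_otherBichromatic hP ha.2 ha.1 hr
  choose! g hg hrg using fun r (hr : r ∈ R \ L) => h.exists_otherBichromatic hP hb.2 hb.1 hr
  rw [← Finset.card_product]
  refine Finset.card_le_card_of_injOn (fun r => (f r, g r))
    (fun r hr => by simpa using ⟨hf r hr, hg r hr⟩) ?_
  intro r hr s hs hrs
  by_contra hne
  simp only [Prod.mk.injEq] at hrs
  have h1 := hf r hr
  have h2 := hg r hr
  simp only [otherBichromatic, Finset.mem_filter, mem_bichromaticMembers] at h1 h2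
  have heq := h.unique _ h1.1.1 _ h2.1.1 r s hne (hrf r hr) (hrs.1 ▸ hrf s hs) (hrg r hr)
    (hrs.2 ▸ hrg s hs)
  exact h1.2.2 (h.unique _ h1.1.1 L hL a b hab h1.2.1 (heq ▸ h2.2.1) ha.1 hb.1)

/-- Lower bound for a sum of positive integers whose pairwise products are at least `j`. -/
lemma _root_.Finset.sum_lower_bound_of_mul_ge {S : Finset α} {f : α → ℕ} {j : ℕ} (hS : S.Nonempty)
    (hpos : ∀ a ∈ S, 1 ≤ f a) (hmul : ∀ a ∈ S, ∀ b ∈ S, a ≠ b → j ≤ f a * f b) :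
    1 + j * (S.card - 1) ≤ ∑ a ∈ S, f a ∨ 2 + 2 * (S.card - 1) ≤ ∑ a ∈ S, f a ∧
        2 + (j + 1) / 2 * (S.card - 1) ≤ ∑ a ∈ S, f a
      ∨ 3 * S.card ≤ ∑ a ∈ S, f a := by
  obtain ⟨m, hm, hmin⟩ := S.exists_min_image f hS
  have key (c : ℕ) (hc : ∀ b ∈ S, b ≠ m → c ≤ f b) : f m + c * (S.card - 1) ≤ ∑ a ∈ S, f a := by
    rw [← Finset.add_sum_erase S f hm, ← Finset.card_erase_of_mem hm, mul_comm]
    have := Finset.card_nsmul_le_sum (S.erase m) f c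
      (fun b hb => hc b (Finset.mem_of_mem_erase hb) (Finset.ne_of_mem_erase hb))
    simpa using this
  have := hpos m hm
  rcases (show f m = 1 ∨ f m = 2 ∨ 3 ≤ f m by omega) with h1 | h1 | h1
  · left
    have := key j fun b hb hbm => by simpa [h1] using hmul m hm b hb hbm.symm
    omega
  · right; left
    have h2 := key 2 fun b hb _ => h1 ▸ hmin b hb
    have h3 := key ((j + 1) / 2) fun b hb hbm => by
      have := hmul m hm b hb hbm.symm
      rw [h1] at this; omega
    omega
  · right; right
    have := Finset.card_nsmul_le_sum S f 3 fun b hb => h1.trans (hmin b hb)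
    simpa [mul_comm] using this

lemma sum_otherBichromatic_lower_bound (h : IsLinearSpace P 𝓛) (hP : P = R ∪ B) (hL : L ∈ 𝓛)
    (hx : 1 ≤ (L ∩ B).card) (hj : 1 ≤ (R \ L).card) :
    1 + (R \ L).card * ((L ∩ B).card - 1) ≤ ∑ a ∈ L ∩ B, (otherBichromatic 𝓛 R B L a).card
    ∨ 2 + 2 * ((L ∩ B).card - 1) ≤ ∑ a ∈ L ∩ B, (otherBichromatic 𝓛 R B L a).card
      ∧ 2 + ((R \ L).card + 1) / 2 * ((L ∩ B).card - 1)
        ≤ ∑ a ∈ L ∩ B, (otherBichromatic 𝓛 R B L a).card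
    ∨ 3 * (L ∩ B).card ≤ ∑ a ∈ L ∩ B, (otherBichromatic 𝓛 R B L a).card := by
  refine Finset.sum_lower_bound_of_mul_ge (Finset.card_pos.1 hx) (fun a ha => ?_)
    fun a ha b hb hab => h.card_sdiff_le_mul hP ha hb hab hL
  obtain ⟨r, hr⟩ := Finset.card_pos.1 hj
  rw [Finset.mem_inter] at ha
  obtain ⟨M, hM, -⟩ := h.exists_otherBichromatic hP ha.2 ha.1 hr
  exact Finset.card_pos.2 ⟨M, hM⟩

/-- The bichromatic members through the points of `L`, counted by the colour of the point. -/
lemma sum_otherBichromatic_add_le (h : IsLinearSpace P 𝓛) (hP : P = R ∪ B) (hRB : Disjoint R B)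
    (hL : L ∈ 𝓛) :
    (if 1 ≤ (L ∩ R).card ∧ 1 ≤ (L ∩ B).card then 1 else 0)
      + ∑ a ∈ L ∩ R, (otherBichromatic 𝓛 R B L a).card
      + ∑ a ∈ L ∩ B, (otherBichromatic 𝓛 R B L a).card ≤ (bichromaticMembers 𝓛 R B).card := by
  have h1 := h.sum_otherBichromatic_le (R := R) (B := B) hL
  have h2 : L = (L ∩ R) ∪ (L ∩ B) := by
    rw [← Finset.inter_union_distrib_left, ← hP, Finset.inter_eq_left.2 (h.subset L hL)]
  have h3 : ∑ q ∈ L, (otherBichromatic 𝓛 R B L q).card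
      = ∑ a ∈ L ∩ R, (otherBichromatic 𝓛 R B L a).card
        + ∑ a ∈ L ∩ B, (otherBichromatic 𝓛 R B L a).card := by
    rw [← Finset.sum_union (hRB.mono Finset.inter_subset_right Finset.inter_subset_right), ← h2]
  have h4 : L ∈ bichromaticMembers 𝓛 R B ↔ 1 ≤ (L ∩ R).card ∧ 1 ≤ (L ∩ B).card := by
    simp [mem_bichromaticMembers, hL, Nat.one_le_iff_ne_zero, Finset.nonempty_iff_ne_empty]
  simp only [h4] at h1
  omega

/-- Everything the members through the points of a fixed member tell about the number `T` of
bichromatic members, with the two partial sums as witnesses. -/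
lemma exists_partial_sums (h : IsLinearSpace P 𝓛) (hP : P = R ∪ B) (hRB : Disjoint R B)
    (hL : L ∈ 𝓛) :
    ∃ s t : ℕ, (if 1 ≤ (L ∩ R).card ∧ 1 ≤ (L ∩ B).card then 1 else 0) + s + t
        ≤ (bichromaticMembers 𝓛 R B).card ∧
      (1 ≤ (L ∩ B).card → 1 ≤ (R \ L).card →
        1 + (R \ L).card * ((L ∩ B).card - 1) ≤ t ∨
        2 + 2 * ((L ∩ B).card - 1) ≤ t ∧
          2 + ((R \ L).card + 1) / 2 * ((L ∩ B).card - 1) ≤ t ∨ 3 * (L ∩ B).card ≤ t) ∧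
      (1 ≤ (L ∩ R).card → 1 ≤ (B \ L).card →
        1 + (B \ L).card * ((L ∩ R).card - 1) ≤ s ∨
        2 + 2 * ((L ∩ R).card - 1) ≤ s ∧
          2 + ((B \ L).card + 1) / 2 * ((L ∩ R).card - 1) ≤ s ∨ 3 * (L ∩ R).card ≤ s) := by
  refine ⟨_, _, h.sum_otherBichromatic_add_le hP hRB hL,
    h.sum_otherBichromatic_lower_bound hP hL, ?_⟩
  have := h.sum_otherBichromatic_lower_bound (R := B) (B := R) (by rw [hP, Finset.union_comm]) hL
  simpa only [otherBichromatic_comm 𝓛 B R] using this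

end IsLinearSpace

end LinearSpace

section Counting

variable {α : Type*} [DecidableEq α]

namespace IsLinearSpace

variable {P R B L : Finset α} {𝓛 : Finset (Finset α)}

lemma card_inter_add_card_sdiff (A L : Finset α) : (L ∩ A).card + (A \ L).card = A.card := by
  rw [Finset.inter_comm]; exact Finset.card_inter_add_card_sdiff A L

/-- A member missing only two points forces many bichromatic members. -/
lemma card_sub_one_le_of_card_add_two (h : IsLinearSpace P 𝓛) (hP : P = R ∪ B)
    (hRB : Disjoint R B) (hcard : B.card = R.card ∨ B.card + 1 = R.card) (hL : L ∈ 𝓛)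
    (h2 : L.card + 2 = P.card) (h4 : 4 ≤ P.card) :
    P.card - 1 ≤ (bichromaticMembers 𝓛 R B).card := by
  obtain ⟨s, t, hT, ht, hs⟩ := h.exists_partial_sums hP hRB hL
  have h5 := h.card_eq_add hP hRB hL
  have h6 : P.card = R.card + B.card := by rw [hP, Finset.card_union_of_disjoint hRB]
  have h7 := card_inter_add_card_sdiff R L
  have h8 := card_inter_add_card_sdiff B L
  generalize (bichromaticMembers 𝓛 R B).card = T at *
  generalize (L ∩ R).card = y at *
  generalize (L ∩ B).card = x at *
  generalize (R \ L).card = j at *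
  generalize (B \ L).card = i at *
  have hj : j ≤ 2 := by omega
  have hi : i ≤ 2 := by omega
  interval_cases j <;> interval_cases i <;> (try omega) <;> split_ifs at hT <;> omega

/-- The consequence of Melchior's inequality for the bichromatic members. -/
lemma sum_loss_le (h : IsLinearSpace P 𝓛) (hP : P = R ∪ B) (hRB : Disjoint R B)
    (hM : 3 ≤ ∑ L ∈ 𝓛, (3 - L.card : ℤ)) :
    ∑ L ∈ bichromaticMembers 𝓛 R B,
      ((L ∩ R).card + (L ∩ B).card + ((L ∩ R).card - (L ∩ B).card) ^ 2 - 4 : ℤ)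
      ≤ 2 * (bichromaticMembers 𝓛 R B).card - 6 - (R.card + B.card)
        + (R.card - B.card : ℤ) ^ 2 := by
  have h1 := h.sum_card_sub_sq hP hRB
  have h2 : ∑ L ∈ 𝓛, (6 - L.card - ((L ∩ R).card - (L ∩ B).card : ℤ) ^ 2)
      = 2 * ∑ L ∈ 𝓛, (3 - L.card : ℤ)
        + ∑ L ∈ 𝓛, ((L.card : ℤ) - ((L ∩ R).card - (L ∩ B).card : ℤ) ^ 2) := by
    rw [Finset.mul_sum, ← Finset.sum_add_distrib]
    exact Finset.sum_congr rfl fun L _ => by ring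
  have h3 : ∑ L ∈ 𝓛, (6 - L.card - ((L ∩ R).card - (L ∩ B).card : ℤ) ^ 2)
      ≤ ∑ L ∈ bichromaticMembers 𝓛 R B,
        (6 - L.card - ((L ∩ R).card - (L ∩ B).card : ℤ) ^ 2) := by
    rw [← Finset.sum_sdiff (s₁ := bichromaticMembers 𝓛 R B) (s₂ := 𝓛) (Finset.filter_subset _ _)]
    refine add_le_of_nonpos_left (Finset.sum_nonpos fun L hL => ?_)
    obtain ⟨hL, hnb⟩ := Finset.mem_sdiff.1 hL
    have h5 := h.card_eq_add hP hRB hL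
    have h6 := h.two_le L hL
    have h7 : (L ∩ R).card = 0 ∨ (L ∩ B).card = 0 := by
      rw [mem_bichromaticMembers] at hnb
      simp only [Finset.card_eq_zero, ← Finset.not_nonempty_iff_eq_empty]
      tauto
    rcases h7 with h7 | h7 <;> rw [h7] at h5 <;> zify at h5 h6 <;> rw [h7, h5] <;>
      rw [h5] at h6 <;> push_cast at h6 ⊢ <;> nlinarith
  have h4 : ∑ L ∈ bichromaticMembers 𝓛 R B,
        (6 - L.card - ((L ∩ R).card - (L ∩ B).card : ℤ) ^ 2)
      = ∑ L ∈ bichromaticMembers 𝓛 R B, (2 : ℤ) - ∑ L ∈ bichromaticMembers 𝓛 R B,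
      ((L ∩ R).card + (L ∩ B).card + ((L ∩ R).card - (L ∩ B).card) ^ 2 - 4 : ℤ) := by
    rw [← Finset.sum_sub_distrib]
    refine Finset.sum_congr rfl fun L hL => ?_
    rw [h.card_eq_add hP hRB (mem_bichromaticMembers.1 hL).1]
    push_cast; ring
  rw [Finset.sum_const, nsmul_eq_mul] at h4
  linarith

/-- Sums vanishing on monochromatic members may be restricted to bichromatic ones. -/
lemma sum_bichromaticMembers_mul (h : IsLinearSpace P 𝓛) (hP : P = R ∪ B) (hRB : Disjoint R B) :
    ∑ L ∈ bichromaticMembers 𝓛 R B, ((L ∩ B).card * (L ∩ R).card - 4 : ℤ)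
      = B.card * R.card - 4 * (bichromaticMembers 𝓛 R B).card := by
  have h1 := h.sum_card_mul_card (A := R) (C := B) (hP ▸ Finset.subset_union_left)
    (hP ▸ Finset.subset_union_right) hRB
  rw [Finset.sum_sub_distrib, Finset.sum_const, nsmul_eq_mul, mul_comm (_ : ℤ) 4]
  congr 1
  norm_cast
  rw [← h1]
  refine Finset.sum_subset (Finset.filter_subset _ _) fun L hL hnb => ?_
  rw [mem_bichromaticMembers] at hnb
  simp only [mul_eq_zero, Finset.card_eq_zero, ← Finset.not_nonempty_iff_eq_empty]
  tauto

/-- The bichromatic members through a blue point partition the red points. -/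
lemma sum_bichromatic_star (h : IsLinearSpace P 𝓛) (hP : P = R ∪ B) (hRB : Disjoint R B) {q : α}
    (hq : q ∈ B) :
    ∑ L ∈ (bichromaticMembers 𝓛 R B).filter (fun L => q ∈ L), (L ∩ R).card = R.card := by
  rw [← h.sum_card_inter_star (A := R) (hP ▸ Finset.subset_union_left)
    (hP ▸ Finset.mem_union_right _ hq) (Finset.disjoint_right.1 hRB hq)]
  refine Finset.sum_subset (Finset.filter_subset_filter _ (Finset.filter_subset _ _)) ?_
  intro L hL hnb
  simp only [Finset.mem_filter, mem_bichromaticMembers] at hL hnb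
  rw [Finset.card_eq_zero, ← Finset.not_nonempty_iff_eq_empty]
  exact fun hne => hnb ⟨⟨hL.1, hne, ⟨q, by simp [hL.2, hq]⟩⟩, hL.2⟩

/-- If the number of red points is odd, every blue point is on a bichromatic member with an odd
number of red points. -/
lemma card_le_sum_odd (h : IsLinearSpace P 𝓛) (hP : P = R ∪ B) (hRB : Disjoint R B)
    (hodd : Odd R.card) :
    (B.card : ℤ) ≤ ∑ L ∈ bichromaticMembers 𝓛 R B,
      if Odd (L ∩ R).card then ((L ∩ B).card : ℤ) else 0 := by
  rw [← Finset.sum_filter]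
  norm_cast
  have hsub : B ⊆ ((bichromaticMembers 𝓛 R B).filter (fun L => Odd (L ∩ R).card)).biUnion
      (fun L => L ∩ B) := by
    intro q hq
    by_contra hcon
    simp only [Finset.mem_biUnion, Finset.mem_filter, Finset.mem_inter, not_exists, not_and] at hcon
    rw [← h.sum_bichromatic_star hP hRB hq] at hodd
    refine Nat.not_even_iff_odd.2 hodd (Finset.even_sum _ fun L hL => ?_)
    rw [Finset.mem_filter] at hL
    by_contra hne
    exact hcon L ⟨hL.1, Nat.not_even_iff_odd.1 hne⟩ hL.2 hq
  exact (Finset.card_le_card hsub).trans Finset.card_biUnion_le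

/-- If all bichromatic members have two red points, every blue point is on `|R| / 2` of them. -/
lemma two_mul_card_otherBichromatic (h : IsLinearSpace P 𝓛) (hP : P = R ∪ B)
    (hRB : Disjoint R B) (h2 : ∀ M ∈ bichromaticMembers 𝓛 R B, (M ∩ R).card = 2)
    (hL : L ∈ bichromaticMembers 𝓛 R B) {q : α} (hq : q ∈ L ∩ B) :
    2 * (otherBichromatic 𝓛 R B L q).card + 2 = R.card := by
  rw [Finset.mem_inter] at hq
  rw [← h.sum_bichromatic_star hP hRB hq.2, Finset.sum_congr rfl fun M hM =>
    h2 M (Finset.mem_filter.1 hM).1, Finset.sum_const, smul_eq_mul]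
  have : otherBichromatic 𝓛 R B L q
      = ((bichromaticMembers 𝓛 R B).filter (fun L => q ∈ L)).erase L := by
    ext M; simp [otherBichromatic]; tauto
  have h3 := Finset.card_erase_add_one
    (s := (bichromaticMembers 𝓛 R B).filter (fun L => q ∈ L)) (a := L) (by simp [hL, hq.1])
  rw [this]
  omega

/-- A bichromatic member containing all but few of the red and of the blue points forces
many bichromatic members. -/
lemma card_lt_of_large_member (h : IsLinearSpace P 𝓛) (hP : P = R ∪ B) (hRB : Disjoint R B)
    (hcard : B.card = R.card ∨ B.card + 1 = R.card)
    (hL : L ∈ 𝓛) (h2 : L.card + 3 ≤ P.card) (hy : 3 ≤ (L ∩ R).card)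
    (hx : 3 ≤ (L ∩ B).card) (hy' : R.card ≤ (L ∩ R).card + 7)
    (hx' : R.card ≤ (L ∩ B).card + 7) (h7 : 7 ≤ R.card) :
    P.card < (bichromaticMembers 𝓛 R B).card + 2 := by
  obtain ⟨s, t, hT, ht, hs⟩ := h.exists_partial_sums hP hRB hL
  have h5 := h.card_eq_add hP hRB hL
  have h6 : P.card = R.card + B.card := by rw [hP, Finset.card_union_of_disjoint hRB]
  have h7 := card_inter_add_card_sdiff R L
  have h8 := card_inter_add_card_sdiff B L
  rw [if_pos (by omega)] at hT
  generalize (bichromaticMembers 𝓛 R B).card = T at *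
  generalize (L ∩ R).card = y at *
  generalize (L ∩ B).card = x at *
  generalize (R \ L).card = j at *
  generalize (B \ L).card = i at *
  have hj : j ≤ 7 := by omega
  have hi : i ≤ 7 := by omega
  replace hs := hs (by omega)
  replace ht := ht (by omega)
  clear h
  by_contra hcon
  interval_cases j <;> interval_cases i <;> omega

end IsLinearSpace

end Counting

section Extremal

/-- A product is controlled by the loss once the smaller factor is at most `M`. -/
lemma two_mul_mul_sub_le {x y M : ℤ} (hM : 2 ≤ M) (hx : 1 ≤ x) (hy : 2 ≤ y)
    (h : x ≤ M ∨ y ≤ M) :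
    2 * (x * y - 4) ≤ (M + 2) * (y + x + (y - x) ^ 2 - 4) := by
  have main (a b : ℤ) (ha : 2 ≤ a) (hab : a ≤ b) (haM : a ≤ M) :
      2 * (a * b - 4) ≤ (M + 2) * (b + a + (b - a) ^ 2 - 4) := by
    obtain ⟨d, rfl⟩ : ∃ d, b = a + d := ⟨b - a, by ring⟩
    have hd : 0 ≤ d := by linarith
    have h1 : 0 ≤ (M - a) * (2 * (a - 2) + d + d ^ 2) := by
      apply mul_nonneg <;> nlinarith
    have h2 : d ≤ d ^ 2 := by nlinarith
    nlinarith [mul_nonneg hd (by linarith : (0 : ℤ) ≤ a - 2)]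
  rcases le_or_gt 2 x with hx2 | hx2
  · rcases le_total x y with hxy | hxy
    · have := main x y hx2 hxy (by omega)
      nlinarith
    · have := main y x hy hxy (by omega)
      nlinarith
  · obtain rfl : x = 1 := by omega
    nlinarith [mul_nonneg (by linarith : (0 : ℤ) ≤ M - 2) (by nlinarith :
      (0 : ℤ) ≤ y + 1 + (y - 1) ^ 2 - 4)]

lemma mul_sub_le_of_min_le_two {x y : ℤ} (hx : 1 ≤ x) (hy : 2 ≤ y) (h : x ≤ 2 ∨ y ≤ 2) :
    x * y - 4 ≤ y + x + (y - x) ^ 2 - 4 := by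
  rcases h with h | h
  · obtain rfl | rfl : x = 1 ∨ x = 2 := by omega
    · nlinarith
    · nlinarith
  · obtain rfl : y = 2 := by omega
    rcases le_or_gt 2 x with h | h
    · nlinarith
    · obtain rfl : x = 1 := by omega
      norm_num

/-- The loss is nonnegative, and is at least two on a member that is not a pair of reds with one
or two blues. -/
lemma loss_nonneg {x y : ℤ} (hy : 2 ≤ y) (hx : 1 ≤ x) :
    0 ≤ y + x + (y - x) ^ 2 - 4 := by
  rcases lt_or_ge 1 x with h | h
  · nlinarith
  · nlinarith

lemma two_le_loss_of_three_le {x y : ℤ} (hy : 3 ≤ y) :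
    2 ≤ y + x + (y - x) ^ 2 - 4 := by
  rcases le_or_gt 3 x with h | h
  · nlinarith
  · nlinarith

variable {α : Type*} [DecidableEq α]

/-- The situation of a minimal counterexample. -/
structure IsCritical (P R B : Finset α) (𝓛 : Finset (Finset α)) : Prop where
  isLinearSpace : IsLinearSpace P 𝓛
  union : P = R ∪ B
  disjoint : Disjoint R B
  balanced : B.card = R.card ∨ B.card + 1 = R.card
  melchior : 3 ≤ ∑ L ∈ 𝓛, (3 - L.card : ℤ)
  card_add_three_le : ∀ L ∈ 𝓛, L.card + 3 ≤ P.card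
  card_bichromatic : (bichromaticMembers 𝓛 R B).card + 2 = P.card
  two_le_red : ∀ L ∈ bichromaticMembers 𝓛 R B, 2 ≤ (L ∩ R).card
  two_le_blue : B.card = R.card → ∀ L ∈ bichromaticMembers 𝓛 R B, 2 ≤ (L ∩ B).card

namespace IsCritical

variable {P R B L : Finset α} {𝓛 : Finset (Finset α)}

lemma card_add_card (h : IsCritical P R B 𝓛) :
    (bichromaticMembers 𝓛 R B).card + 2 = R.card + B.card := by
  rw [h.card_bichromatic, h.union, Finset.card_union_of_disjoint h.disjoint]

lemma one_le_blue (hL : L ∈ bichromaticMembers 𝓛 R B) : 1 ≤ (L ∩ B).card :=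
  Finset.card_pos.2 (mem_bichromaticMembers.1 hL).2.2

lemma sum_loss_le (h : IsCritical P R B 𝓛) :
    ∑ L ∈ bichromaticMembers 𝓛 R B,
      ((L ∩ R).card + (L ∩ B).card + ((L ∩ R).card - (L ∩ B).card) ^ 2 - 4 : ℤ)
      ≤ 2 * R.card - 10 := by
  refine (h.isLinearSpace.sum_loss_le h.union h.disjoint h.melchior).trans ?_
  have h1 := h.card_add_card
  zify at h1
  rcases h.balanced with h2 | h2 <;> zify at h2
  · rw [h2] at h1 ⊢; nlinarith
  · rw [← h2] at h1 ⊢; nlinarith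

lemma sum_mul_sub (h : IsCritical P R B 𝓛) :
    ∑ L ∈ bichromaticMembers 𝓛 R B, ((L ∩ B).card * (L ∩ R).card - 4 : ℤ)
      = B.card * R.card - 4 * (R.card + B.card - 2) := by
  rw [h.isLinearSpace.sum_bichromaticMembers_mul h.union h.disjoint]
  have h1 := h.card_add_card
  zify at h1
  linarith

lemma loss_nonneg (h : IsCritical P R B 𝓛) (hL : L ∈ bichromaticMembers 𝓛 R B) :
    0 ≤ ((L ∩ R).card + (L ∩ B).card + ((L ∩ R).card - (L ∩ B).card) ^ 2 - 4 : ℤ) :=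
  _root_.loss_nonneg (mod_cast h.two_le_red L hL) (mod_cast one_le_blue hL)

lemma loss_le (h : IsCritical P R B 𝓛) (hL : L ∈ bichromaticMembers 𝓛 R B) :
    ((L ∩ R).card + (L ∩ B).card + ((L ∩ R).card - (L ∩ B).card) ^ 2 - 4 : ℤ)
      ≤ 2 * R.card - 10 :=
  (Finset.single_le_sum (f := fun L => ((L ∩ R).card + (L ∩ B).card
    + ((L ∩ R).card - (L ∩ B).card) ^ 2 - 4 : ℤ)) (fun _ hM => h.loss_nonneg hM) hL).trans
    h.sum_loss_le

lemma five_le (h : IsCritical P R B 𝓛) : 5 ≤ R.card := by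
  have := (Finset.sum_nonneg fun L hL => h.loss_nonneg hL).trans h.sum_loss_le
  omega

/-- No member is large in both colours. -/
lemma not_large (h : IsCritical P R B 𝓛) (hL : L ∈ bichromaticMembers 𝓛 R B) (h7 : 7 ≤ R.card)
    (hy : 3 ≤ (L ∩ R).card) (hx : 3 ≤ (L ∩ B).card) (hy' : R.card ≤ (L ∩ R).card + 7)
    (hx' : R.card ≤ (L ∩ B).card + 7) : False := by
  have hL' := (mem_bichromaticMembers.1 hL).1
  have := h.isLinearSpace.card_lt_of_large_member h.union h.disjoint h.balanced hL'
    (h.card_add_three_le L hL') hy hx hy' hx' h7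
  have := h.card_bichromatic
  omega

lemma sum_mul_le (h : IsCritical P R B 𝓛) {M : ℤ} (hM : 2 ≤ M)
    (hmin : ∀ L ∈ bichromaticMembers 𝓛 R B, ((L ∩ B).card : ℤ) ≤ M ∨ ((L ∩ R).card : ℤ) ≤ M) :
    2 * (B.card * R.card - 4 * (R.card + B.card - 2) : ℤ) ≤ (M + 2) * (2 * R.card - 10) := by
  rw [← h.sum_mul_sub, Finset.mul_sum]
  refine le_trans (Finset.sum_le_sum fun L hL => two_mul_mul_sub_le hM
    (mod_cast one_le_blue hL) (mod_cast h.two_le_red L hL) (hmin L hL)) ?_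
  rw [← Finset.mul_sum]
  exact mul_le_mul_of_nonneg_left h.sum_loss_le (by linarith)

lemma sum_mul_le_of_two (h : IsCritical P R B 𝓛)
    (hmin : ∀ L ∈ bichromaticMembers 𝓛 R B, (L ∩ B).card ≤ 2 ∨ (L ∩ R).card ≤ 2) :
    (B.card * R.card - 4 * (R.card + B.card - 2) : ℤ) ≤ 2 * R.card - 10 := by
  rw [← h.sum_mul_sub]
  refine le_trans (Finset.sum_le_sum fun L hL => mul_sub_le_of_min_le_two
    (mod_cast one_le_blue hL) (mod_cast h.two_le_red L hL) (mod_cast hmin L hL)) h.sum_loss_le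

lemma min_le_two (h : IsCritical P R B 𝓛) (h7 : 7 ≤ R.card) (h10 : R.card < 10) :
    ∀ L ∈ bichromaticMembers 𝓛 R B, (L ∩ B).card ≤ 2 ∨ (L ∩ R).card ≤ 2 := by
  intro L hL
  by_contra! hcon
  exact h.not_large hL h7 (by omega) (by omega) (by omega) (by omega)

lemma card_lt_ten (h : IsCritical P R B 𝓛) : R.card < 10 := by
  by_contra! h10
  have := h.sum_mul_le (M := R.card - 8) (by omega) fun L hL => by
    by_contra! hcon
    exact h.not_large hL (by omega) (by omega) (by omega) (by omega) (by omega)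
  zify at h10
  rcases h.balanced with h2 | h2 <;> zify at h2
  · rw [h2] at this; nlinarith
  · rw [show (B.card : ℤ) = R.card - 1 by linarith] at this; nlinarith

lemma blue_card (h : IsCritical P R B 𝓛) : B.card + 1 = R.card := by
  refine h.balanced.resolve_left fun heq => ?_
  have h1 := h.sum_mul_sub
  have h2 := h.five_le
  have h3 := h.card_lt_ten
  have h4 : ∀ L ∈ bichromaticMembers 𝓛 R B, 0 ≤ ((L ∩ B).card * (L ∩ R).card - 4 : ℤ) := by
    intro L hL
    have h5 := h.two_le_red L hL
    have h6 := h.two_le_blue heq L hL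
    zify at h5 h6
    nlinarith
  rw [heq] at h1
  rcases lt_or_ge R.card 8 with h8 | h8
  · have h9 := Finset.sum_nonneg h4
    rw [h1] at h9
    have h7 : R.card = 7 := by
      interval_cases R.card <;> first | rfl | (norm_num at h9)
    rw [h7, show ((7 : ℕ) * (7 : ℕ) - 4 * ((7 : ℕ) + (7 : ℕ) - 2) : ℤ) = 1 by norm_num] at h1
    obtain ⟨L, hL, hne⟩ := Finset.exists_ne_zero_of_sum_ne_zero (h1 ▸ one_ne_zero)
    have h10 := Finset.single_le_sum h4 hL
    rw [h1] at h10
    have h11 : (L ∩ B).card * (L ∩ R).card = 5 := by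
      have := h4 L hL
      zify
      omega
    have h5 := h.two_le_red L hL
    have h6 := h.two_le_blue heq L hL
    have h12 : (L ∩ B).card ∣ 5 := ⟨_, h11.symm⟩
    rcases (Nat.dvd_prime (by norm_num)).1 h12 with h13 | h13
    · omega
    · rw [h13] at h11; omega
  · have := h.sum_mul_le_of_two (h.min_le_two (by omega) h3)
    rw [heq] at this
    interval_cases R.card <;> norm_num at this

lemma card_ne_nine (h : IsCritical P R B 𝓛) : R.card ≠ 9 := by
  intro h9
  have h1 := h.sum_mul_le_of_two (h.min_le_two (by omega) (by omega))
  have h2 := h.blue_card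
  rw [show B.card = 8 by omega, h9] at h1
  norm_num at h1

lemma card_ne_five (h : IsCritical P R B 𝓛) : R.card ≠ 5 := by
  intro h5
  have h1 := h.blue_card
  have h2 : ∀ L ∈ bichromaticMembers 𝓛 R B, (L ∩ R).card = 2 := by
    intro L hL
    by_contra hne
    have h3 := h.two_le_red L hL
    have h4 := two_le_loss_of_three_le (x := (L ∩ B).card) (y := (L ∩ R).card)
      (by omega)
    have h6 := h.loss_le hL
    rw [h5] at h6
    norm_num at h6
    linarith
  have h3 := h.isLinearSpace.card_le_sum_odd h.union h.disjoint (by rw [h5]; decide)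
  rw [Finset.sum_eq_zero fun L hL => by rw [h2 L hL, if_neg (by decide)]] at h3
  omega

lemma card_ne_seven (h : IsCritical P R B 𝓛) : R.card ≠ 7 := by
  intro h7
  have h1 := h.blue_card
  have h2 := h.isLinearSpace.card_le_sum_odd h.union h.disjoint (by rw [h7]; decide)
  have h3 := h.sum_loss_le
  have h4 := h.min_le_two (by omega) (by omega)
  have h5 : ∀ L ∈ bichromaticMembers 𝓛 R B,
      (if Odd (L ∩ R).card then ((L ∩ B).card : ℤ) else 0)
      ≤ ((L ∩ R).card + (L ∩ B).card + ((L ∩ R).card - (L ∩ B).card) ^ 2 - 4 : ℤ) := by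
    intro L hL
    split_ifs with ho
    · have h6 := h.two_le_red L hL
      have h8 := one_le_blue hL
      have h9 : 3 ≤ (L ∩ R).card := by
        rcases h6.lt_or_eq with h6 | h6
        · exact h6
        · rw [← h6] at ho; exact absurd ho (by decide)
      have h10 : (L ∩ B).card ≤ 2 := by have := h4 L hL; omega
      zify at h9
      interval_cases (L ∩ B).card <;> push_cast <;> nlinarith
    · exact h.loss_nonneg hL
  have := (h2.trans (Finset.sum_le_sum h5)).trans h3
  omega

lemma card_ne_eight (h : IsCritical P R B 𝓛) : R.card ≠ 8 := by
  intro h8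
  have h1 := h.blue_card
  have hB : B.card = 7 := by omega
  have h2 := h.isLinearSpace.card_le_sum_odd (R := B) (B := R)
    (by rw [h.union, Finset.union_comm]) h.disjoint.symm (by rw [hB]; decide)
  rw [bichromaticMembers_comm] at h2
  have h3 := h.sum_loss_le
  have h4 := h.min_le_two (by omega) (by omega)
  have hmul := h.sum_mul_sub
  rw [hB, h8, show ((7 : ℕ) * (8 : ℕ) - 4 * ((8 : ℕ) + (7 : ℕ) - 2) : ℤ) = 4 by norm_num] at hmul
  set F : Finset α → ℤ := fun L =>
    2 * ((L ∩ R).card + (L ∩ B).card + ((L ∩ R).card - (L ∩ B).card) ^ 2 - 4 : ℤ)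
      - ((L ∩ B).card * (L ∩ R).card - 4)
      - (if Odd (L ∩ B).card then ((L ∩ R).card : ℤ) else 0) with hF
  have hF0 : ∀ L ∈ bichromaticMembers 𝓛 R B, 0 ≤ F L ∧
      (F L = 0 → (L ∩ R).card = 2 ∧ (L ∩ B).card ≤ 3) := by
    intro L hL
    have h6 := h.two_le_red L hL
    have h7 := one_le_blue hL
    have h9 := h4 L hL
    simp only [hF]
    clear_value F
    generalize (L ∩ R).card = y at *
    generalize (L ∩ B).card = x at *
    rcases (show x = 1 ∨ x = 2 ∨ (y = 2 ∧ 3 ≤ x) by omega) with rfl | rfl | ⟨rfl, hx⟩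
    · rw [if_pos (by decide)]
      zify at h6 ⊢
      refine ⟨by nlinarith, fun h0 => ⟨?_, by norm_num⟩⟩
      by_contra hne
      have : (3 : ℤ) ≤ y := by omega
      nlinarith
    · rw [if_neg (by decide)]
      zify at h6 ⊢
      refine ⟨by nlinarith, fun h0 => ⟨?_, by norm_num⟩⟩
      by_contra hne
      have : (3 : ℤ) ≤ y := by omega
      nlinarith
    · have h10 : ((if Odd x then ((2 : ℕ) : ℤ) else 0) : ℤ) ≤ 2 := by split_ifs <;> norm_num
      zify at hx ⊢
      refine ⟨by push_cast at *; nlinarith, fun h0 => ⟨by trivial, ?_⟩⟩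
      by_contra! hne
      have : (4 : ℤ) ≤ x := by omega
      push_cast at *
      nlinarith
  have hsum : ∑ L ∈ bichromaticMembers 𝓛 R B, F L ≤ 0 := by
    simp only [hF]
    rw [Finset.sum_sub_distrib, Finset.sum_sub_distrib, hmul, ← Finset.mul_sum]
    rw [h8] at h2 h3
    push_cast at h2 h3
    linarith
  have hzero := (Finset.sum_eq_zero_iff_of_nonneg fun L hL => (hF0 L hL).1).1
    (le_antisymm hsum (Finset.sum_nonneg fun L hL => (hF0 L hL).1))
  have hy : ∀ L ∈ bichromaticMembers 𝓛 R B, (L ∩ R).card = 2 :=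
    fun L hL => ((hF0 L hL).2 (hzero L hL)).1
  obtain ⟨L, hL, hpos⟩ : ∃ L ∈ bichromaticMembers 𝓛 R B,
      0 < ((L ∩ B).card * (L ∩ R).card - 4 : ℤ) := by
    by_contra! hcon
    have := Finset.sum_nonpos hcon
    rw [hmul] at this
    norm_num at this
  have hx3 := ((hF0 L hL).2 (hzero L hL)).2
  have hyL := hy L hL
  rw [hyL] at hpos
  have hx : (L ∩ B).card = 3 := by push_cast at hpos; omega
  have hL' := (mem_bichromaticMembers.1 hL).1
  have h10 := h.isLinearSpace.sum_otherBichromatic_add_le h.union h.disjoint hL'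
  have h11 : ∑ a ∈ L ∩ B, (otherBichromatic 𝓛 R B L a).card = ∑ _a ∈ L ∩ B, 3 := by
    refine Finset.sum_congr rfl fun a ha => ?_
    have := h.isLinearSpace.two_mul_card_otherBichromatic h.union h.disjoint hy hL ha
    omega
  have h12 := h.isLinearSpace.sum_otherBichromatic_lower_bound (R := B) (B := R)
    (by rw [h.union, Finset.union_comm]) hL'
  simp only [otherBichromatic_comm 𝓛 B R] at h12
  have h13 := IsLinearSpace.card_inter_add_card_sdiff B L
  have h14 := h.card_add_card
  rw [h11, hyL, hx, if_pos (by omega), Finset.sum_const, hx, smul_eq_mul] at h10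
  rw [hyL, show (B \ L).card = 4 by omega] at h12
  omega

lemma card_eq_six (h : IsCritical P R B 𝓛) : R.card = 6 ∧ B.card = 5 := by
  have h1 := h.blue_card
  have h2 := h.five_le
  have h3 := h.card_lt_ten
  have h4 := h.card_ne_five
  have h5 := h.card_ne_seven
  have h6 := h.card_ne_eight
  have h7 := h.card_ne_nine
  omega

lemma card_inter_red (h : IsCritical P R B 𝓛) :
    ∀ L ∈ bichromaticMembers 𝓛 R B, (L ∩ R).card = 2 := by
  obtain ⟨hR, hB⟩ := h.card_eq_six
  intro L hL
  by_contra hne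
  have h3 := h.two_le_red L hL
  have h4 := two_le_loss_of_three_le (x := (L ∩ B).card) (y := (L ∩ R).card)
    (by omega)
  have h5 := h.sum_loss_le
  rw [hR, ← Finset.add_sum_erase _ _ hL] at h5
  have h6 : ∀ M ∈ (bichromaticMembers 𝓛 R B).erase L, (M ∩ R).card = 2 := by
    intro M hM
    have hM' := Finset.mem_of_mem_erase hM
    by_contra hne'
    have h7 := h.two_le_red M hM'
    have h8 := two_le_loss_of_three_le (x := (M ∩ B).card) (y := (M ∩ R).card)
      (by omega)
    have h9 := Finset.single_le_sum (f := fun L => ((L ∩ R).card + (L ∩ B).card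
      + ((L ∩ R).card - (L ∩ B).card) ^ 2 - 4 : ℤ))
      (fun _ hM => h.loss_nonneg (Finset.mem_of_mem_erase hM)) hM
    push_cast at h5
    linarith
  have h7 : (L ∩ R).card = 3 := by
    have h8 := Finset.sum_nonneg (s := (bichromaticMembers 𝓛 R B).erase L)
      (f := fun L => ((L ∩ R).card + (L ∩ B).card
      + ((L ∩ R).card - (L ∩ B).card) ^ 2 - 4 : ℤ))
      (fun _ hM => h.loss_nonneg (Finset.mem_of_mem_erase hM))
    by_contra hne3
    have h9 : (4 : ℤ) ≤ (L ∩ R).card := by omega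
    have h10 : (1 : ℤ) ≤ (L ∩ B).card := mod_cast one_le_blue hL
    push_cast at h5
    rcases le_or_gt ((L ∩ B).card : ℤ) 3 with h11 | h11
    · nlinarith
    · nlinarith [sq_nonneg ((L ∩ R).card - (L ∩ B).card : ℤ)]
  obtain ⟨q, hq⟩ := (mem_bichromaticMembers.1 hL).2.2
  rw [Finset.mem_inter] at hq
  have h8 := h.isLinearSpace.sum_bichromatic_star h.union h.disjoint hq.2
  rw [← Finset.add_sum_erase _ _ (show L ∈ _ by simp [hL, hq.1]), Finset.sum_congr rfl
    (g := fun _ => 2), Finset.sum_const, h7, hR, smul_eq_mul] at h8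
  · omega
  · intro M hM
    rw [Finset.mem_erase, Finset.mem_filter] at hM
    exact h6 M (Finset.mem_erase.2 ⟨hM.1, hM.2.1⟩)

lemma card_inter_blue (h : IsCritical P R B 𝓛) :
    ∀ L ∈ bichromaticMembers 𝓛 R B, (L ∩ B).card ≤ 2 := by
  obtain ⟨hR, hB⟩ := h.card_eq_six
  intro L hL
  by_contra! hx
  have hy := h.card_inter_red L hL
  have h1 := h.loss_le hL
  rw [hR, hy] at h1
  have hx3 : (L ∩ B).card = 3 := by
    by_contra hne
    have : (4 : ℤ) ≤ (L ∩ B).card := by omega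
    push_cast at h1
    nlinarith
  have hL' := (mem_bichromaticMembers.1 hL).1
  have h10 := h.isLinearSpace.sum_otherBichromatic_add_le h.union h.disjoint hL'
  have h11 : ∑ a ∈ L ∩ B, (otherBichromatic 𝓛 R B L a).card = ∑ _a ∈ L ∩ B, 2 := by
    refine Finset.sum_congr rfl fun a ha => ?_
    have := h.isLinearSpace.two_mul_card_otherBichromatic h.union h.disjoint h.card_inter_red hL ha
    omega
  have h12 := h.isLinearSpace.sum_otherBichromatic_lower_bound (R := B) (B := R)
    (by rw [h.union, Finset.union_comm]) hL'
  simp only [otherBichromatic_comm 𝓛 B R] at h12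
  have h13 := IsLinearSpace.card_inter_add_card_sdiff B L
  have h14 := h.card_add_card
  rw [h11, hy, hx3, if_pos (by omega), Finset.sum_const, hx3, smul_eq_mul] at h10
  rw [hy, show (B \ L).card = 2 by omega] at h12
  omega

end IsCritical

end Extremal

section SixFive

variable {α : Type*} [DecidableEq α]

/-- Three points on a common member of `𝓛`. -/
def Coll (𝓛 : Finset (Finset α)) (x y z : α) : Prop :=
  ∃ L ∈ 𝓛, x ∈ L ∧ y ∈ L ∧ z ∈ L

lemma IsLinearSpace.card_sdiff_le {P R B L : Finset α} {𝓛 : Finset (Finset α)}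
    (h : IsLinearSpace P 𝓛) (hP : P = R ∪ B) {k : ℕ}
    (hk : ∀ M ∈ bichromaticMembers 𝓛 R B, (M ∩ R).card ≤ k) {a : α} (ha : a ∈ B) (haL : a ∈ L) :
    (R \ L).card ≤ (otherBichromatic 𝓛 R B L a).card * k := by
  refine le_trans (Finset.card_le_card ?_) (Finset.card_biUnion_le_card_mul
    (otherBichromatic 𝓛 R B L a) (fun M => M ∩ R) k fun M hM => hk M (Finset.mem_filter.1 hM).1)
  intro r hr
  obtain ⟨M, hM, hrM⟩ := h.exists_otherBichromatic hP ha haL hr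
  exact Finset.mem_biUnion.2 ⟨M, hM, Finset.mem_inter.2 ⟨hrM, (Finset.mem_sdiff.1 hr).1⟩⟩

namespace IsCritical

variable {P R B L : Finset α} {𝓛 : Finset (Finset α)}

lemma eq_of_mem (h : IsCritical P R B 𝓛) {M N : Finset α} (hM : M ∈ bichromaticMembers 𝓛 R B)
    (hN : N ∈ bichromaticMembers 𝓛 R B) {x y : α} (hxy : x ≠ y) (hxM : x ∈ M) (hyM : y ∈ M)
    (hxN : x ∈ N) (hyN : y ∈ N) : M = N :=
  h.isLinearSpace.unique M (mem_bichromaticMembers.1 hM).1 N (mem_bichromaticMembers.1 hN).1 x y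
    hxy hxM hyM hxN hyN

lemma exists_mem (h : IsCritical P R B 𝓛) {x y : α} (hx : x ∈ R) (hy : y ∈ B) :
    ∃ M ∈ bichromaticMembers 𝓛 R B, x ∈ M ∧ y ∈ M := by
  obtain ⟨M, hM, hxM, hyM⟩ := h.isLinearSpace.exists_line x
    (by rw [h.union]; exact Finset.mem_union_left _ hx) y
    (by rw [h.union]; exact Finset.mem_union_right _ hy)
    (by rintro rfl; exact Finset.disjoint_left.1 h.disjoint hx hy)
  exact ⟨M, mem_bichromaticMembers.2 ⟨hM, ⟨x, by simp [hxM, hx]⟩, ⟨y, by simp [hyM, hy]⟩⟩,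
    hxM, hyM⟩

lemma not_three_red (h : IsCritical P R B 𝓛) {M : Finset α} (hM : M ∈ bichromaticMembers 𝓛 R B)
    {x y z : α} (hx : x ∈ R) (hy : y ∈ R) (hz : z ∈ R) (hxM : x ∈ M) (hyM : y ∈ M) (hzM : z ∈ M)
    (hxy : x ≠ y) (hxz : x ≠ z) (hyz : y ≠ z) : False := by
  have h1 := h.card_inter_red M hM
  have h2 : ({x, y, z} : Finset α) ⊆ M ∩ R := by
    simp [Finset.insert_subset_iff, *]
  have h3 := Finset.card_le_card h2
  rw [Finset.card_eq_three.2 ⟨x, y, z, hxy, hxz, hyz, rfl⟩] at h3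
  omega

lemma exists_red_ne (h : IsCritical P R B 𝓛) {M : Finset α} (hM : M ∈ bichromaticMembers 𝓛 R B)
    (x : α) : ∃ y ∈ R, y ∈ M ∧ y ≠ x := by
  obtain ⟨y, hy, hyx⟩ := Finset.exists_mem_ne (s := M ∩ R)
    (by rw [h.card_inter_red M hM]; norm_num) x
  rw [Finset.mem_inter] at hy
  exact ⟨y, hy.2, hy.1, hyx⟩

lemma ne_of_mem (h : IsCritical P R B 𝓛) {x y : α} (hx : x ∈ R) (hy : y ∈ B) : x ≠ y := by
  rintro rfl; exact Finset.disjoint_left.1 h.disjoint hx hy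

/-- A member with two red and two blue points. -/
lemma exists_two_two (h : IsCritical P R B 𝓛) :
    ∃ L ∈ bichromaticMembers 𝓛 R B, (L ∩ B).card = 2 := by
  by_contra! hcon
  have h1 := h.sum_mul_sub
  obtain ⟨hR, hB⟩ := h.card_eq_six
  have hT := h.card_add_card
  rw [Finset.sum_congr rfl (g := fun _ => -2), Finset.sum_const, hR, hB,
    show (bichromaticMembers 𝓛 R B).card = 9 by omega] at h1
  · norm_num at h1
  · intro L hL
    have h2 := hcon L hL
    have h3 := h.card_inter_blue L hL
    have h4 := one_le_blue hL
    rw [h.card_inter_red L hL, show (L ∩ B).card = 1 by omega]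
    norm_num

lemma two_le_card_otherBichromatic (h : IsCritical P R B 𝓛) (hL : L ∈ bichromaticMembers 𝓛 R B)
    (hx : (L ∩ B).card = 2) {q : α} (hq : q ∈ L) :
    2 ≤ (otherBichromatic 𝓛 R B L q).card := by
  obtain ⟨hR, hB⟩ := h.card_eq_six
  have hy := h.card_inter_red L hL
  have h1 := IsLinearSpace.card_inter_add_card_sdiff R L
  have h2 := IsLinearSpace.card_inter_add_card_sdiff B L
  have hqP := h.isLinearSpace.subset L (mem_bichromaticMembers.1 hL).1 hq
  rw [h.union, Finset.mem_union] at hqP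
  rcases hqP with hqR | hqB
  · have := h.isLinearSpace.card_sdiff_le (R := B) (B := R) (k := 2) (L := L)
      (by rw [h.union, Finset.union_comm])
      (by rw [bichromaticMembers_comm]; exact h.card_inter_blue) hqR hq
    rw [otherBichromatic_comm] at this
    omega
  · have := h.isLinearSpace.card_sdiff_le h.union (k := 2)
      (fun M hM => (h.card_inter_red M hM).le) hqB hq
    omega

/-- Around a member with two red and two blue points the count is tight: every point of it lies on
exactly two other bichromatic members, and these are all the remaining ones. -/
lemma tight (h : IsCritical P R B 𝓛) (hL : L ∈ bichromaticMembers 𝓛 R B)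
    (hx : (L ∩ B).card = 2) :
    (∀ q ∈ L, (otherBichromatic 𝓛 R B L q).card = 2) ∧
      ∀ M ∈ bichromaticMembers 𝓛 R B, M ≠ L → ∃ q ∈ L, q ∈ M := by
  have hL' := (mem_bichromaticMembers.1 hL).1
  obtain ⟨hR, hB⟩ := h.card_eq_six
  have hT := h.card_add_card
  have hk := h.isLinearSpace.card_eq_add h.union h.disjoint hL'
  rw [h.card_inter_red L hL, hx] at hk
  have hsum := h.isLinearSpace.sum_otherBichromatic_le (R := R) (B := B) hL'
  rw [if_pos hL] at hsum
  refine ⟨fun q hq => ?_, fun M hM hML => ?_⟩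
  · rw [← Finset.add_sum_erase _ _ hq] at hsum
    have h1 := Finset.card_nsmul_le_sum (L.erase q)
      (fun q => (otherBichromatic 𝓛 R B L q).card) 2
      fun r hr => h.two_le_card_otherBichromatic hL hx (Finset.mem_of_mem_erase hr)
    rw [Finset.card_erase_of_mem hq, hk, smul_eq_mul] at h1
    have h2 := h.two_le_card_otherBichromatic hL hx hq
    omega
  · by_contra! hcon
    have h1 : L.biUnion (otherBichromatic 𝓛 R B L)
        ⊆ ((bichromaticMembers 𝓛 R B).erase L).erase M := by
      intro N hN
      simp only [Finset.mem_biUnion, otherBichromatic, Finset.mem_filter] at hN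
      obtain ⟨q, hqL, h1, hqN, h2⟩ := hN
      exact Finset.mem_erase.2 ⟨by rintro rfl; exact hcon q hqL hqN, Finset.mem_erase.2 ⟨h2, h1⟩⟩
    have h2 := Finset.card_le_card h1
    rw [h.isLinearSpace.card_biUnion_otherBichromatic hL', Finset.card_erase_of_mem
      (Finset.mem_erase.2 ⟨hML, hM⟩), Finset.card_erase_of_mem hL] at h2
    have h3 := Finset.card_nsmul_le_sum L
      (fun q => (otherBichromatic 𝓛 R B L q).card) 2
      fun r hr => h.two_le_card_otherBichromatic hL hx hr
    rw [hk, smul_eq_mul] at h3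
    omega

/-- A critical configuration contains a MacLane configuration. -/
theorem exists_macLane (h : IsCritical P R B 𝓛) :
    ∃ p ∈ P, ∃ q ∈ P, ∃ s ∈ P, ∃ b d c u v : α, ¬ Coll 𝓛 p q s ∧ b ≠ p ∧ b ≠ q ∧ d ≠ p ∧ u ≠ s ∧
      Coll 𝓛 p q b ∧ Coll 𝓛 p s d ∧ Coll 𝓛 p u v ∧ Coll 𝓛 b d c ∧ Coll 𝓛 q c u ∧
      Coll 𝓛 s c v ∧ Coll 𝓛 b s u ∧ Coll 𝓛 d q v := by
  obtain ⟨hR, hB⟩ := h.card_eq_six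
  obtain ⟨L, hL, hx⟩ := h.exists_two_two
  obtain ⟨htwo, hmeet⟩ := h.tight hL hx
  have hy := h.card_inter_red L hL
  have hLP := h.isLinearSpace.subset L (mem_bichromaticMembers.1 hL).1
  have hmem {M : Finset α} (hM : M ∈ bichromaticMembers 𝓛 R B) : M ∈ 𝓛 :=
    (mem_bichromaticMembers.1 hM).1
  obtain ⟨b, d, hbd, hbdL⟩ := Finset.card_eq_two.1 hx
  obtain ⟨a, c, hac, hacL⟩ := Finset.card_eq_two.1 hy
  have hb : b ∈ L ∩ B := by rw [hbdL]; simp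
  have hd : d ∈ L ∩ B := by rw [hbdL]; simp
  have ha : a ∈ L ∩ R := by rw [hacL]; simp
  have hc : c ∈ L ∩ R := by rw [hacL]; simp
  rw [Finset.mem_inter] at hb hd ha hc
  obtain ⟨hbL, hbB⟩ := hb
  obtain ⟨hdL, hdB⟩ := hd
  obtain ⟨haL, haR⟩ := ha
  obtain ⟨hcL, hcR⟩ := hc
  have hRL := IsLinearSpace.card_inter_add_card_sdiff R L
  have hBL := IsLinearSpace.card_inter_add_card_sdiff B L
  have hL4 : ∀ z ∈ L, z = a ∨ z = c ∨ z = b ∨ z = d := by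
    intro z hz
    have h1 := hLP hz
    rw [h.union, Finset.mem_union] at h1
    rcases h1 with h1 | h1
    · have : z ∈ L ∩ R := Finset.mem_inter.2 ⟨hz, h1⟩
      rw [hacL] at this; simp at this; tauto
    · have : z ∈ L ∩ B := Finset.mem_inter.2 ⟨hz, h1⟩
      rw [hbdL] at this; simp at this; tauto
  choose! f hf huf using fun u (hu : u ∈ B \ L) =>
    h.isLinearSpace.exists_otherBichromatic (R := B) (B := R)
      (by rw [h.union, Finset.union_comm]) haR haL hu
  simp only [otherBichromatic_comm 𝓛 B R] at hf
  obtain ⟨u, hu, v, hv, huv, hfuv⟩ := Finset.exists_ne_map_eq_of_card_lt_of_maps_to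
    (by rw [htwo a haL]; omega) hf
  have hA := hf u hu
  have huA := huf u hu
  have hvA := huf v hv
  rw [← hfuv] at hvA
  clear hfuv
  generalize f u = A at hA huA hvA
  simp only [otherBichromatic, Finset.mem_filter] at hA
  obtain ⟨hA, haA, hAL⟩ := hA
  rw [Finset.mem_sdiff] at hu hv
  obtain ⟨huB, huL⟩ := hu
  obtain ⟨hvB, hvL⟩ := hv
  obtain ⟨p, hpR, hpA, hpa⟩ := h.exists_red_ne hA a
  have hcA : c ∉ A := fun hcA => hAL (h.eq_of_mem hA hL hac haA hcA haL hcL)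
  have hpL : p ∉ L := fun hpL => hAL (h.eq_of_mem hA hL hpa hpA haA hpL haL)
  obtain ⟨M₁, hM₁, hpM₁, hbM₁⟩ := h.exists_mem hpR hbB
  obtain ⟨M₂, hM₂, hpM₂, hdM₂⟩ := h.exists_mem hpR hdB
  obtain ⟨q, hqR, hqM₁, hqp⟩ := h.exists_red_ne hM₁ p
  obtain ⟨s, hsR, hsM₂, hsp⟩ := h.exists_red_ne hM₂ p
  have hqL : q ∉ L := fun hqL =>
    hpL (h.eq_of_mem hM₁ hL (h.ne_of_mem hqR hbB) hqM₁ hbM₁ hqL hbL ▸ hpM₁)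
  have hsL : s ∉ L := fun hsL =>
    hpL (h.eq_of_mem hM₂ hL (h.ne_of_mem hsR hdB) hsM₂ hdM₂ hsL hdL ▸ hpM₂)
  have hqs : q ≠ s := by
    rintro rfl
    have h1 := h.eq_of_mem hM₁ hM₂ hqp hqM₁ hpM₁ hsM₂ hpM₂
    subst h1
    exact hpL (h.eq_of_mem hM₁ hL hbd hbM₁ hdM₂ hbL hdL ▸ hpM₁)
  obtain ⟨r, hr⟩ : ((R \ L) \ {p, q, s}).Nonempty := by
    rw [← Finset.card_pos, Finset.card_sdiff_of_subset]
    · rw [Finset.card_eq_three.2 ⟨p, q, s, hqp.symm, hsp.symm, hqs, rfl⟩]; omega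
    · simp [Finset.insert_subset_iff, *]
  simp only [Finset.mem_sdiff, Finset.mem_insert, Finset.mem_singleton, not_or] at hr
  obtain ⟨⟨hrR, hrL⟩, hrp, hrq, hrs⟩ := hr
  have hpr : p ≠ r := Ne.symm hrp
  have hqr : q ≠ r := Ne.symm hrq
  have hsr : s ≠ r := Ne.symm hrs
  have hR6 : ∀ x ∈ R, x = a ∨ x = c ∨ x = p ∨ x = q ∨ x = s ∨ x = r := by
    intro x hxR
    by_contra! hcon
    obtain ⟨h1, h2, h3, h4, h5, h6⟩ := hcon
    have h7 : ({a, c, p, q, s, r, x} : Finset α) ⊆ R := by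
      simp [Finset.insert_subset_iff, *]
    have h8 := Finset.card_le_card h7
    have hane : ∀ y, y ∉ L → a ≠ y := by rintro y hy rfl; exact hy haL
    have hcne : ∀ y, y ∉ L → c ≠ y := by rintro y hy rfl; exact hy hcL
    rw [Finset.card_insert_of_notMem, Finset.card_insert_of_notMem, Finset.card_insert_of_notMem,
      Finset.card_insert_of_notMem, Finset.card_insert_of_notMem, Finset.card_insert_of_notMem,
      Finset.card_singleton] at h8
    · omega
    · simpa using h6.symm
    · simp [hsr, h5.symm]
    · simp [hqs, hqr, h4.symm]
    · simp [hqp.symm, hsp.symm, hpr, h3.symm]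
    · simp [*, h2.symm]
    · simp [*, h1.symm]
  have hca : c ≠ a := hac.symm
  have hpq := hqp.symm
  have hps := hsp.symm
  have hcp : c ≠ p := by rintro rfl; exact hpL hcL
  have haq : a ≠ q := by rintro rfl; exact hqL haL
  have has : a ≠ s := by rintro rfl; exact hsL haL
  have hcq : c ≠ q := by rintro rfl; exact hqL hcL
  have hcs : c ≠ s := by rintro rfl; exact hsL hcL
  -- the second red point on the member through `c` and a blue point of `A`
  have partner : ∀ w ∈ B, w ∈ A → w ∉ L → ∃ C ∈ bichromaticMembers 𝓛 R B,
      c ∈ C ∧ w ∈ C ∧ (q ∈ C ∨ s ∈ C) := by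
    intro w hwB hwA hwL
    obtain ⟨C, hC, hcC, hwC⟩ := h.exists_mem hcR hwB
    refine ⟨C, hC, hcC, hwC, ?_⟩
    obtain ⟨g, hgR, hgC, hgc⟩ := h.exists_red_ne hC c
    rcases hR6 g hgR with rfl | rfl | rfl | rfl | rfl | rfl
    · exact absurd (h.eq_of_mem hC hL hac hgC hcC haL hcL ▸ hwC) hwL
    · exact absurd rfl hgc
    · exact absurd (h.eq_of_mem hC hA (h.ne_of_mem hgR hwB) hgC hwC hpA hwA ▸ hcC) hcA
    · exact Or.inl hgC
    · exact Or.inr hgC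
    · exfalso
      obtain ⟨Q, hQ, hqQ, hwQ⟩ := h.exists_mem hqR hwB
      obtain ⟨t, htR, htQ, htq⟩ := h.exists_red_ne hQ q
      have hQA : Q ≠ A := by
        rintro rfl
        exact h.not_three_red hQ haR hpR hqR haA hpA hqQ hpa.symm haq hqp.symm
      have hQC : Q ≠ C := by
        rintro rfl
        exact h.not_three_red hQ hcR hgR hqR hcC hgC hqQ hgc.symm hcq hrq
      have hsQ : s ∈ Q := by
        rcases hR6 t htR with rfl | rfl | rfl | rfl | rfl | rfl
        · exact absurd (h.eq_of_mem hQ hA (h.ne_of_mem htR hwB) htQ hwQ haA hwA) hQA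
        · exact absurd (h.eq_of_mem hQ hC (h.ne_of_mem htR hwB) htQ hwQ hcC hwC) hQC
        · exact absurd (h.eq_of_mem hQ hA (h.ne_of_mem htR hwB) htQ hwQ hpA hwA) hQA
        · exact absurd rfl htq
        · exact htQ
        · exact absurd (h.eq_of_mem hQ hC (h.ne_of_mem htR hwB) htQ hwQ hgC hwC) hQC
      obtain ⟨z, hzL, hzQ⟩ := hmeet Q hQ (by rintro rfl; exact hqL hqQ)
      rcases hL4 z hzL with rfl | rfl | rfl | rfl
      · exact h.not_three_red hQ haR hqR hsR hzQ hqQ hsQ haq has hqs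
      · exact h.not_three_red hQ hcR hqR hsR hzQ hqQ hsQ hcq hcs hqs
      · have := h.eq_of_mem hQ hM₁ (h.ne_of_mem hqR hbB) hqQ hzQ hqM₁ hbM₁
        subst this
        exact h.not_three_red hQ hpR hqR hsR hpM₁ hqQ hsQ hpq hps hqs
      · have := h.eq_of_mem hQ hM₂ (h.ne_of_mem hsR hdB) hsQ hzQ hsM₂ hdM₂
        subst this
        exact h.not_three_red hQ hpR hqR hsR hpM₂ hqQ hsQ hpq hps hqs
  -- members through opposite vertices of the quadrilateral `p q r s`
  have opposite : ∀ e M k l w C, e ∈ L → e ∈ B → M ∈ bichromaticMembers 𝓛 R B → e ∈ M → p ∈ M →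
      k ∈ M → k ∈ R → l ∈ R → l ∉ L → p ≠ k → p ≠ l → k ≠ l → a ≠ l → c ≠ l → c ≠ k →
      (∀ x ∈ R, x = a ∨ x = c ∨ x = p ∨ x = k ∨ x = l ∨ x = r) → r ≠ l →
      w ∈ B → w ∈ A → C ∈ bichromaticMembers 𝓛 R B → c ∈ C → k ∈ C → w ∈ C → Coll 𝓛 e l w := by
    intro e M k l w C heL heB hM heM hpM hkM hkR hlR hlL hpk hpl hkl hal hcl hck hR6 hrl hwB hwA
      hC hcC hkC hwC
    obtain ⟨E, hE, hlE, heE⟩ := h.exists_mem hlR heB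
    obtain ⟨W, hW, hlW, hwW⟩ := h.exists_mem hlR hwB
    have hEL : E ≠ L := by rintro rfl; exact hlL hlE
    have hEM : E ≠ M := by
      rintro rfl; exact h.not_three_red hM hpR hkR hlR hpM hkM hlE hpk hpl hkl
    have hWA : W ≠ A := by
      rintro rfl; exact h.not_three_red hA haR hpR hlR haA hpA hlW hpa.symm hal hpl
    have hWC : W ≠ C := by
      rintro rfl; exact h.not_three_red hC hcR hkR hlR hcC hkC hlW hck hcl hkl
    have hrE : r ∈ E := by
      obtain ⟨t, htR, htE, htl⟩ := h.exists_red_ne hE l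
      rcases hR6 t htR with rfl | rfl | rfl | rfl | rfl | rfl
      · exact absurd (h.eq_of_mem hE hL (h.ne_of_mem htR heB) htE heE haL heL) hEL
      · exact absurd (h.eq_of_mem hE hL (h.ne_of_mem htR heB) htE heE hcL heL) hEL
      · exact absurd (h.eq_of_mem hE hM (h.ne_of_mem htR heB) htE heE hpM heM) hEM
      · exact absurd (h.eq_of_mem hE hM (h.ne_of_mem htR heB) htE heE hkM heM) hEM
      · exact absurd rfl htl
      · exact htE
    have hrW : r ∈ W := by
      obtain ⟨t, htR, htW, htl⟩ := h.exists_red_ne hW l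
      rcases hR6 t htR with rfl | rfl | rfl | rfl | rfl | rfl
      · exact absurd (h.eq_of_mem hW hA (h.ne_of_mem htR hwB) htW hwW haA hwA) hWA
      · exact absurd (h.eq_of_mem hW hC (h.ne_of_mem htR hwB) htW hwW hcC hwC) hWC
      · exact absurd (h.eq_of_mem hW hA (h.ne_of_mem htR hwB) htW hwW hpA hwA) hWA
      · exact absurd (h.eq_of_mem hW hC (h.ne_of_mem htR hwB) htW hwW hkC hwC) hWC
      · exact absurd rfl htl
      · exact htW
    have := h.eq_of_mem hE hW hrl hrE hlE hrW hlW
    subst this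
    exact ⟨E, hmem hE, heE, hlE, hwW⟩
  have conclude : ∀ u v C D, u ∈ B → v ∈ B → u ∈ A → v ∈ A → C ∈ bichromaticMembers 𝓛 R B →
      D ∈ bichromaticMembers 𝓛 R B → c ∈ C → q ∈ C → u ∈ C → c ∈ D → s ∈ D → v ∈ D →
      ∃ p ∈ P, ∃ q ∈ P, ∃ s ∈ P, ∃ b d c u v : α, ¬ Coll 𝓛 p q s ∧ b ≠ p ∧ b ≠ q ∧ d ≠ p ∧ u ≠ s ∧
      Coll 𝓛 p q b ∧ Coll 𝓛 p s d ∧ Coll 𝓛 p u v ∧ Coll 𝓛 b d c ∧ Coll 𝓛 q c u ∧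
      Coll 𝓛 s c v ∧ Coll 𝓛 b s u ∧ Coll 𝓛 d q v := by
    intro u v C D huB hvB huA hvA hC hD hcC hqC huC hcD hsD hvD
    have hRP : R ⊆ P := by rw [h.union]; exact Finset.subset_union_left
    refine ⟨p, hRP hpR, q, hRP hqR, s, hRP hsR, b, d, c, u, v, ?_, (h.ne_of_mem hpR hbB).symm,
      (h.ne_of_mem hqR hbB).symm, (h.ne_of_mem hpR hdB).symm, (h.ne_of_mem hsR huB).symm,
      ⟨M₁, hmem hM₁, hpM₁, hqM₁, hbM₁⟩, ⟨M₂, hmem hM₂, hpM₂, hsM₂, hdM₂⟩,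
      ⟨A, hmem hA, hpA, huA, hvA⟩, ⟨L, hmem hL, hbL, hdL, hcL⟩, ⟨C, hmem hC, hqC, hcC, huC⟩,
      ⟨D, hmem hD, hsD, hcD, hvD⟩, ?_, ?_⟩
    · rintro ⟨K, hK, hpK, hqK, hsK⟩
      have := h.isLinearSpace.unique K hK M₁ (hmem hM₁) p q hpq hpK hqK hpM₁ hqM₁
      subst this
      exact h.not_three_red hM₁ hpR hqR hsR hpK hqK hsK hpq hps hqs
    · exact opposite b M₁ q s u C hbL hbB hM₁ hbM₁ hpM₁ hqM₁ hqR hsR hsL hpq hps hqs has hcs hcq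
        hR6 hrs huB huA hC hcC hqC huC
    · exact opposite d M₂ s q v D hdL hdB hM₂ hdM₂ hpM₂ hsM₂ hsR hqR hqL hps hpq hqs.symm haq hcq
        hcs (fun x hx => by have := hR6 x hx; tauto) hrq hvB hvA hD hcD hsD hvD
  obtain ⟨C, hC, hcC, huC, hgC⟩ := partner u huB huA huL
  obtain ⟨D, hD, hcD, hvD, hgD⟩ := partner v hvB hvA hvL
  have hCD : C ≠ D := by
    rintro rfl
    exact hcA (h.eq_of_mem hC hA huv huC hvD huA hvA ▸ hcC)
  rcases hgC with hqC | hsC <;> rcases hgD with hqD | hsD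
  · exact absurd (h.eq_of_mem hC hD hcq hcC hqC hcD hqD) hCD
  · exact conclude u v C D huB hvB huA hvA hC hD hcC hqC huC hcD hsD hvD
  · exact conclude v u D C hvB huB hvA huA hD hC hcD hqD hvD hcC hsC huC
  · exact absurd (h.eq_of_mem hC hD hcs hcC hsC hcD hsD) hCD

end IsCritical

end SixFive

section MacLane

/-- Twice the signed area of the triangle `p q z`. -/
def cross (p q z : ℝ × ℝ) : ℝ :=
  (q.1 - p.1) * (z.2 - p.2) - (q.2 - p.2) * (z.1 - p.1)

lemma false_of_macLane_normalized {β γ c₁ c₂ u₁ u₂ v₁ v₂ : ℝ} (hβ : β ≠ 0) (hβ' : β ≠ 1)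
    (hγ : γ ≠ 0) (hu : u₁ ≠ 0 ∨ u₂ ≠ 1) (h1 : u₁ + β * u₂ = β) (h2 : γ * v₁ + v₂ = γ)
    (h3 : u₁ * v₂ = u₂ * v₁) (h4 : γ * c₁ + β * c₂ = β * γ) (h5 : (c₁ - 1) * u₂ = c₂ * (u₁ - 1))
    (h6 : c₁ * (v₂ - 1) = v₁ * (c₂ - 1)) : False := by
  have hu₁ : u₁ ≠ 0 := by
    rintro rfl
    have : u₂ = 1 := mul_left_cancel₀ hβ (by linarith)
    simp [this] at hu
  obtain ⟨m, hm⟩ : ∃ m, u₂ = m * u₁ := ⟨u₂ / u₁, by field_simp⟩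
  subst hm
  have hv₂ : v₂ = m * v₁ := mul_left_cancel₀ hu₁ (by linarith)
  subst hv₂
  have hdet : γ * v₁ * (u₁ + m * u₁ - 1) + β * (m * u₁) * (v₁ + m * v₁ - 1)
      + β * γ * (1 - u₁ - m * v₁) = 0 := by
    linear_combination (m * u₁ * v₁ + (1 - u₁) * (m * v₁ - 1)) * h4
      - (γ * v₁ + β * (m * v₁ - 1)) * h5 - (γ * (1 - u₁) - β * (m * u₁)) * h6
  have h1' : u₁ * (1 + β * m) = β := by linarith
  have h2' : v₁ * (m + γ) = γ := by linarith
  have hAB : ((1 - γ) * β * m) ^ 2 - ((1 - γ) * β * m) * (γ * (1 - β))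
      + (γ * (1 - β)) ^ 2 = 0 := by
    linear_combination -((1 + β * m) * (m + γ)) * hdet
      + ((γ + β * m) * (1 + m) * v₁ - β * (m + γ)) * (m + γ) * h1'
      + ((γ + β * m) * (1 + m) * β - γ * (1 + β * m) * (1 + β * m)) * h2'
  have : γ * (1 - β) = 0 := by
    nlinarith [sq_nonneg (2 * ((1 - γ) * β * m) - γ * (1 - β)), sq_nonneg (γ * (1 - β))]
  rcases mul_eq_zero.1 this with h | h
  · exact hγ h
  · exact hβ' (by linarith)

/-- The affine coordinates taking `p, q, s` to `(0, 0), (1, 0), (0, 1)` rescale `cross`. -/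
lemma cross_normalize (p q s x y z : ℝ × ℝ) :
    (cross p y s - cross p x s) * (cross p q z - cross p q x)
      - (cross p q y - cross p q x) * (cross p z s - cross p x s)
      = cross p q s * cross x y z := by
  simp only [cross]; ring

/-- The MacLane configuration is not realizable in the real plane. -/
lemma false_of_macLane {p q s b d c u v : ℝ × ℝ} (hD : cross p q s ≠ 0) (hbp : b ≠ p) (hbq : b ≠ q)
    (hdp : d ≠ p) (hus : u ≠ s) (h1 : cross p q b = 0) (h2 : cross p s d = 0)
    (h3 : cross p u v = 0) (h4 : cross b d c = 0) (h5 : cross q c u = 0) (h6 : cross s c v = 0)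
    (h7 : cross b s u = 0) (h8 : cross d q v = 0) : False := by
  have key : ∀ x y z, cross x y z = 0 →
      (cross p y s / cross p q s - cross p x s / cross p q s)
        * (cross p q z / cross p q s - cross p q x / cross p q s)
      - (cross p q y / cross p q s - cross p q x / cross p q s)
        * (cross p z s / cross p q s - cross p x s / cross p q s) = 0 := by
    intro x y z h
    have := cross_normalize p q s x y z
    rw [h, mul_zero] at this
    field_simp
    linarith
  have inj : ∀ x y, cross p x s / cross p q s = cross p y s / cross p q s →
      cross p q x / cross p q s = cross p q y / cross p q s → x = y := by
    intro x y hx hy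
    rw [div_left_inj' hD] at hx hy
    have e1 : cross p q s * (x.1 - y.1) = 0 := by
      simp only [cross] at hx hy ⊢
      linear_combination (q.1 - p.1) * hx + (s.1 - p.1) * hy
    have e2 : cross p q s * (x.2 - y.2) = 0 := by
      simp only [cross] at hx hy ⊢
      linear_combination (q.2 - p.2) * hx + (s.2 - p.2) * hy
    ext
    · exact sub_eq_zero.1 ((mul_eq_zero.1 e1).resolve_left hD)
    · exact sub_eq_zero.1 ((mul_eq_zero.1 e2).resolve_left hD)
  have hps : cross p s d = - cross p d s := by simp only [cross]; ring
  have hp : cross p p s / cross p q s = 0 ∧ cross p q p / cross p q s = 0 := by simp [cross]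
  have hq : cross p q s / cross p q s = 1 ∧ cross p q q / cross p q s = 0 :=
    ⟨div_self hD, by simp [cross, mul_comm]⟩
  have hs : cross p s s / cross p q s = 0 := by simp [cross, mul_comm]
  have hb : cross p q b / cross p q s = 0 := by simp [h1]
  have hd : cross p d s / cross p q s = 0 := by rw [h2] at hps; simp [neg_eq_zero.1 hps.symm]
  have k3 := key _ _ _ h3
  have k4 := key _ _ _ h4
  have k5 := key _ _ _ h5
  have k6 := key _ _ _ h6
  have k7 := key _ _ _ h7
  have k8 := key _ _ _ h8
  have ibp := inj b p
  have ibq := inj b q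
  have idp := inj d p
  have ius := inj u s
  simp only [hp, hq, hs, hb, hd] at k3 k4 k5 k6 k7 k8 ibp ibq idp ius
  refine false_of_macLane_normalized (β := cross p b s / cross p q s)
    (γ := cross p q d / cross p q s) (c₁ := cross p c s / cross p q s)
    (c₂ := cross p q c / cross p q s) (u₁ := cross p u s / cross p q s)
    (u₂ := cross p q u / cross p q s) (v₁ := cross p v s / cross p q s)
    (v₂ := cross p q v / cross p q s) (fun h => hbp (ibp h trivial)) (fun h => hbq (ibq h trivial))
    (fun h => hdp (idp trivial h)) ?_ ?_ ?_ ?_ ?_ ?_ ?_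
  · by_contra! hcon
    exact hus (ius hcon.1 hcon.2)
  · linarith
  · linarith
  · linarith
  · linarith
  · linarith
  · linarith

end MacLane

section Melchior

variable {α : Type*}

/-- A finite linear space drawn in the plane: the point `p` has coordinates `(X p, Y p)`, no two
points lie on a vertical line, and the member `L` consists of the points on a line of slope
`m L`. -/
structure IsSloped (P : Finset α) (𝓛 : Finset (Finset α)) (X Y : α → ℝ) (m : Finset α → ℝ) :
    Prop where
  isLinearSpace : IsLinearSpace P 𝓛
  injOn : ∀ p ∈ P, ∀ q ∈ P, X p = X q → p = q
  mem_iff : ∀ L ∈ 𝓛, ∀ p ∈ L, ∀ q ∈ P, q ∈ L ↔ Y q - Y p = m L * (X q - X p)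

/-- `v` precedes `w` in the cyclic order by slope, without wrapping, among members through `x`. -/
def SlopePred (𝓛 : Finset (Finset α)) (m : Finset α → ℝ) (x : α) (v w : Finset α) : Prop :=
  (x ∈ v ∧ x ∈ w) ∧ m v < m w ∧ ∀ u ∈ 𝓛, x ∈ u → m v < m u → m w ≤ m u

/-- Among the members through `x`, the slope is greatest on `v` and least on `w ≠ v`. -/
def SlopeWrap (𝓛 : Finset (Finset α)) (m : Finset α → ℝ) (x : α) (v w : Finset α) : Prop :=
  (x ∈ v ∧ x ∈ w) ∧ m w < m v ∧ ∀ u ∈ 𝓛, x ∈ u → m w ≤ m u ∧ m u ≤ m v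

/-- The member `w` is charged by the pair `p, p'` of points on the member `v`, where `x` is the
end of `w` under consideration. -/
def Charges (𝓛 : Finset (Finset α)) (m : Finset α → ℝ) (v : Finset α) (p p' x : α)
    (w : Finset α) : Prop :=
  (x = p' ∧ SlopePred 𝓛 m x v w) ∨ (x = p ∧ SlopeWrap 𝓛 m x v w)

/-- The pair `p, p'` of points on `v` charges the right end (`true`) or left end (`false`) of a
member. -/
def ChargesEnd (𝓛 : Finset (Finset α)) (X : α → ℝ) (m : Finset α → ℝ) (v : Finset α) (p p' : α)
    (t : Finset α × Bool) : Prop :=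
  (t.2 = true ∧ ∃ x ∈ t.1, (∀ q ∈ t.1, X q ≤ X x) ∧ Charges 𝓛 m v p p' x t.1) ∨
    (t.2 = false ∧ ∃ x ∈ t.1, (∀ q ∈ t.1, X x ≤ X q) ∧ Charges 𝓛 m v p' p x t.1)

namespace IsSloped

variable {P : Finset α} {𝓛 : Finset (Finset α)} {X Y : α → ℝ} {m : Finset α → ℝ}

/-- Reflection in the origin. -/
lemma neg (h : IsSloped P 𝓛 X Y m) : IsSloped P 𝓛 (fun p => -X p) (fun p => -Y p) m where
  isLinearSpace := h.isLinearSpace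
  injOn p hp q hq hpq := h.injOn p hp q hq (neg_injective hpq)
  mem_iff L hL p hp q hq := by
    rw [h.mem_iff L hL p hp q hq]
    constructor <;> intro h1 <;> linarith

lemma mem (h : IsSloped P 𝓛 X Y m) {L : Finset α} (hL : L ∈ 𝓛) {p : α} (hp : p ∈ L) : p ∈ P :=
  h.isLinearSpace.subset L hL hp

lemma slope (h : IsSloped P 𝓛 X Y m) {L : Finset α} (hL : L ∈ 𝓛) {p q : α} (hp : p ∈ L)
    (hq : q ∈ L) : Y q - Y p = m L * (X q - X p) :=
  (h.mem_iff L hL p hp q (h.mem hL hq)).1 hq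

lemma exists_slope (h : IsSloped P 𝓛 X Y m) {p q : α} (hp : p ∈ P) (hq : q ∈ P)
    (hpq : X p ≠ X q) : ∃ u ∈ 𝓛, p ∈ u ∧ q ∈ u ∧ Y q - Y p = m u * (X q - X p) := by
  obtain ⟨u, hu, hpu, hqu⟩ := h.isLinearSpace.exists_line p hp q hq (by rintro rfl; exact hpq rfl)
  exact ⟨u, hu, hpu, hqu, h.slope hu hpu hqu⟩

lemma eq_of_slope (h : IsSloped P 𝓛 X Y m) {v w : Finset α} (hv : v ∈ 𝓛) (hw : w ∈ 𝓛) {x : α}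
    (hxv : x ∈ v) (hxw : x ∈ w) (hm : m v = m w) : v = w := by
  ext q
  refine ⟨fun hq => ?_, fun hq => ?_⟩
  · exact (h.mem_iff w hw x hxw q (h.mem hv hq)).2 (hm ▸ h.slope hv hxv hq)
  · exact (h.mem_iff v hv x hxv q (h.mem hw hq)).2 (hm ▸ h.slope hw hxw hq)

lemma eq_of_lt (h : IsSloped P 𝓛 X Y m) {v w : Finset α} (hv : v ∈ 𝓛) (hw : w ∈ 𝓛) {p q : α}
    (hpq : X p < X q) (hpv : p ∈ v) (hqv : q ∈ v) (hpw : p ∈ w) (hqw : q ∈ w) : v = w :=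
  h.isLinearSpace.unique v hv w hw p q (by rintro rfl; exact lt_irrefl _ hpq) hpv hqv hpw hqw

lemma le_of_least_above (h : IsSloped P 𝓛 X Y m) {v w : Finset α} (hv : v ∈ 𝓛) (hw : w ∈ 𝓛)
    {p p' : α} (hp : p ∈ v) (hp' : p' ∈ v) (hpp' : X p < X p') (hpw : p' ∈ w) (hvw : m v < m w)
    (hle : ∀ u ∈ 𝓛, p ∈ u → m v < m u → m w ≤ m u) : ∀ q ∈ w, X q ≤ X p' := by
  intro q hq
  by_contra! hlt
  obtain ⟨u, hu, hpu, -, h1⟩ := h.exists_slope (h.mem hv hp) (h.mem hw hq) (by linarith)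
  have h2 := h.slope hv hp hp'
  have h3 := h.slope hw hpw hq
  have h4 : m v < m u := by
    by_contra! hc
    nlinarith [mul_nonneg (sub_nonneg.2 hc) (sub_pos.2 (hpp'.trans hlt)).le,
      mul_pos (sub_pos.2 hvw) (sub_pos.2 hlt)]
  have h5 := hle u hu hpu h4
  nlinarith [mul_nonneg (sub_nonneg.2 h5) (sub_pos.2 (hpp'.trans hlt)).le,
    mul_pos (sub_pos.2 hvw) (sub_pos.2 hpp')]

lemma le_of_least (h : IsSloped P 𝓛 X Y m) {v w : Finset α} (hv : v ∈ 𝓛) (hw : w ∈ 𝓛)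
    {p p' : α} (hp : p ∈ v) (hp' : p' ∈ v) (hpp' : X p < X p') (hpw : p ∈ w) (hvw : m w < m v)
    (hmax : ∀ u ∈ 𝓛, p' ∈ u → m u ≤ m v) (hmin : ∀ u ∈ 𝓛, p' ∈ u → m w ≤ m u) :
    ∀ q ∈ w, X q ≤ X p := by
  intro q hq
  by_contra! hlt
  have hne : X q ≠ X p' := by
    intro heq
    obtain rfl := h.injOn q (h.mem hw hq) p' (h.mem hv hp') heq
    rw [h.eq_of_lt hv hw hpp' hp hp' hpw hq] at hvw
    exact lt_irrefl _ hvw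
  obtain ⟨u, hu, -, hpu, h1⟩ := h.exists_slope (h.mem hw hq) (h.mem hv hp') hne
  have h2 := h.slope hv hp hp'
  have h3 := h.slope hw hpw hq
  have h4 := hmax u hu hpu
  have h5 := hmin u hu hpu
  rcases lt_or_gt_of_ne hne with h6 | h6
  · nlinarith [mul_nonneg (sub_nonneg.2 h4) (sub_pos.2 h6).le,
      mul_pos (sub_pos.2 hvw) (sub_pos.2 hlt)]
  · nlinarith [mul_nonneg (sub_nonneg.2 h5) (sub_pos.2 h6).le,
      mul_pos (sub_pos.2 hvw) (sub_pos.2 hpp')]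

/-- Every pair of points on a member charges an end of some member. -/
lemma exists_chargesEnd (h : IsSloped P 𝓛 X Y m) {v : Finset α} (hv : v ∈ 𝓛) (hvP : v ≠ P) {p p' : α}
    (hp : p ∈ v) (hp' : p' ∈ v) (hpp' : X p < X p') :
    ∃ t : Finset α × Bool, t.1 ∈ 𝓛 ∧ ChargesEnd 𝓛 X m v p p' t := by
  suffices ∃ w ∈ 𝓛, (∃ x ∈ w, (∀ q ∈ w, X q ≤ X x) ∧ Charges 𝓛 m v p p' x w) ∨
      ∃ x ∈ w, (∀ q ∈ w, X x ≤ X q) ∧ Charges 𝓛 m v p' p x w by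
    obtain ⟨w, hw, h1 | h1⟩ := this
    · exact ⟨(w, true), hw, Or.inl ⟨rfl, h1⟩⟩
    · exact ⟨(w, false), hw, Or.inr ⟨rfl, h1⟩⟩
  have hneg : -X p' < -X p := neg_lt_neg hpp'
  by_cases hex : ((𝓛.filter fun u => p ∈ u ∨ p' ∈ u).filter fun u => m v < m u).Nonempty
  · obtain ⟨w, hw, hmin⟩ := Finset.exists_min_image _ m hex
    simp only [Finset.mem_filter, and_imp] at hw hmin
    obtain ⟨⟨hw, hpw⟩, hvw⟩ := hw
    refine ⟨w, hw, ?_⟩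
    rcases hpw with hpw | hpw
    · refine Or.inr ⟨p, hpw, fun q hq => ?_, Or.inl ⟨rfl, ⟨hp, hpw⟩, hvw,
        fun u hu hpu => hmin u hu (Or.inl hpu)⟩⟩
      exact neg_le_neg_iff.1 (h.neg.le_of_least_above hv hw hp' hp hneg hpw hvw
        (fun u hu hpu => hmin u hu (Or.inr hpu)) q hq)
    · exact Or.inl ⟨p', hpw, h.le_of_least_above hv hw hp hp' hpp' hpw hvw
        (fun u hu hpu => hmin u hu (Or.inl hpu)), Or.inl ⟨rfl, ⟨hp', hpw⟩, hvw,
        fun u hu hpu => hmin u hu (Or.inr hpu)⟩⟩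
  · have hmax : ∀ u ∈ 𝓛, p ∈ u ∨ p' ∈ u → m u ≤ m v := by
      intro u hu hpu
      by_contra! hlt
      exact hex ⟨u, by simp [*]⟩
    obtain ⟨r, hrP, hrv⟩ : ∃ r ∈ P, r ∉ v := by
      by_contra! hcon
      exact hvP ((h.isLinearSpace.subset v hv).antisymm hcon)
    obtain ⟨u, hu, hpu, hru⟩ := h.isLinearSpace.exists_line p (h.mem hv hp) r hrP
      (by rintro rfl; exact hrv hp)
    have huv : m u < m v := lt_of_le_of_ne (hmax u hu (Or.inl hpu)) fun heq =>
      hrv (h.eq_of_slope hu hv hpu hp heq ▸ hru)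
    obtain ⟨w, hw, hmin⟩ := Finset.exists_min_image (𝓛.filter fun u => p ∈ u ∨ p' ∈ u) m
      ⟨u, by simp [*]⟩
    simp only [Finset.mem_filter, and_imp] at hw hmin
    obtain ⟨hw, hpw⟩ := hw
    have hwv : m w < m v := (hmin u hu (Or.inl hpu)).trans_lt huv
    refine ⟨w, hw, ?_⟩
    rcases hpw with hpw | hpw
    · exact Or.inl ⟨p, hpw, h.le_of_least hv hw hp hp' hpp' hpw hwv
        (fun u hu hpu => hmax u hu (Or.inr hpu)) (fun u hu hpu => hmin u hu (Or.inr hpu)),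
        Or.inr ⟨rfl, ⟨hp, hpw⟩, hwv,
          fun u hu hpu => ⟨hmin u hu (Or.inl hpu), hmax u hu (Or.inl hpu)⟩⟩⟩
    · refine Or.inr ⟨p', hpw, fun q hq => ?_, Or.inr ⟨rfl, ⟨hp', hpw⟩, hwv,
          fun u hu hpu => ⟨hmin u hu (Or.inr hpu), hmax u hu (Or.inr hpu)⟩⟩⟩
      exact neg_le_neg_iff.1 (h.neg.le_of_least hv hw hp' hp hneg hpw hwv
        (fun u hu hpu => hmax u hu (Or.inl hpu)) (fun u hu hpu => hmin u hu (Or.inl hpu)) q hq)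

lemma charges_unique (h : IsSloped P 𝓛 X Y m) {v v' w : Finset α} (hv : v ∈ 𝓛) (hv' : v' ∈ 𝓛)
    {p p' q q' x : α} (h1 : Charges 𝓛 m v p p' x w) (h2 : Charges 𝓛 m v' q q' x w) :
    v = v' ∧ ((p' = q') ∨ (p = q)) := by
  rcases h1 with ⟨rfl, ⟨hxv, hxw⟩, h3, h4⟩ | ⟨rfl, ⟨hxv, hxw⟩, h3, h4⟩ <;>
  rcases h2 with ⟨rfl, ⟨hxv', -⟩, h5, h6⟩ | ⟨rfl, ⟨hxv', -⟩, h5, h6⟩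
  · refine ⟨h.eq_of_slope hv hv' hxv hxv' (le_antisymm ?_ ?_), Or.inl rfl⟩
    · by_contra! hlt; linarith [h6 v hv hxv hlt]
    · by_contra! hlt; linarith [h4 v' hv' hxv' hlt]
  · linarith [(h6 v hv hxv).1]
  · linarith [(h4 v' hv' hxv').1]
  · exact ⟨h.eq_of_slope hv hv' hxv hxv' (le_antisymm (h6 v hv hxv).2 (h4 v' hv' hxv').2),
      Or.inr rfl⟩

lemma not_charges_of_least {v w : Finset α} (hv : v ∈ 𝓛) {x : α} (hxP : ∀ q ∈ P, X q ≤ X x)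
    (hmin : ∀ u ∈ 𝓛, x ∈ u → m w ≤ m u) {p p' : α} (hp' : p' ∈ P) (hpp' : X p < X p') :
    ¬ Charges 𝓛 m v p p' x w := by
  rintro (⟨rfl, ⟨hxv, -⟩, h3, -⟩ | ⟨rfl, -, -, -⟩)
  · linarith [hmin v hv hxv]
  · linarith [hxP p' hp']

lemma not_charges_of_le (h : IsSloped P 𝓛 X Y m) {v w : Finset α} (hv : v ∈ 𝓛) {x : α}
    (hw : ∀ q ∈ P, Y q - Y x ≤ m w * (X q - X x)) {p p' : α} (hp : p ∈ v)
    (hp' : p' ∈ v) (hpp' : X p < X p') : ¬ Charges 𝓛 m v p p' x w := by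
  have h1 := h.slope hv hp hp'
  rintro (⟨rfl, -, h3, -⟩ | ⟨rfl, -, h3, -⟩)
  · have := hw p (h.mem hv hp)
    nlinarith [mul_pos (sub_pos.2 h3) (sub_pos.2 hpp')]
  · have := hw p' (h.mem hv hp')
    nlinarith [mul_pos (sub_pos.2 h3) (sub_pos.2 hpp')]

/-- All points lie on or below the steepest member through the leftmost point. -/
lemma sub_le_of_steepest (h : IsSloped P 𝓛 X Y m) {w : Finset α} (hw : w ∈ 𝓛) {x₀ x : α}
    (hx₀ : x₀ ∈ w) (hx₀P : ∀ q ∈ P, X x₀ ≤ X q) (hmax : ∀ u ∈ 𝓛, x₀ ∈ u → m u ≤ m w)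
    (hx : x ∈ w) : ∀ q ∈ P, Y q - Y x ≤ m w * (X q - X x) := by
  intro q hq
  have h1 := h.slope hw hx₀ hx
  rcases (hx₀P q hq).eq_or_lt with h2 | h2
  · obtain rfl := h.injOn _ (h.mem hw hx₀) _ hq h2
    linarith
  · obtain ⟨u, hu, hxu, -, h3⟩ := h.exists_slope (h.mem hw hx₀) hq h2.ne
    nlinarith [mul_nonneg (sub_nonneg.2 (hmax u hu hxu)) (sub_pos.2 h2).le]

lemma chargesEnd_unique (h : IsSloped P 𝓛 X Y m) {v v' : Finset α} (hv : v ∈ 𝓛) (hv' : v' ∈ 𝓛)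
    {p p' q q' : α} {t : Finset α × Bool} (ht : t.1 ∈ 𝓛) (h1 : ChargesEnd 𝓛 X m v p p' t)
    (h2 : ChargesEnd 𝓛 X m v' q q' t) : v = v' ∧ (p' = q' ∨ p = q) := by
  rcases h1 with ⟨hb, x, hx, hxm, h1⟩ | ⟨hb, x, hx, hxm, h1⟩ <;>
  rcases h2 with ⟨hb', y, hy, hym, h2⟩ | ⟨hb', y, hy, hym, h2⟩
  · obtain rfl := h.injOn x (h.mem ht hx) y (h.mem ht hy) (le_antisymm (hym x hx) (hxm y hy))
    exact h.charges_unique hv hv' h1 h2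
  · simp [hb] at hb'
  · simp [hb] at hb'
  · obtain rfl := h.injOn x (h.mem ht hx) y (h.mem ht hy) (le_antisymm (hxm y hy) (hym x hx))
    exact (h.charges_unique hv hv' h1 h2).imp_right Or.symm

/-- At least three ends of members are not charged. -/
lemma exists_uncharged (h : IsSloped P 𝓛 X Y m) (hP : ∀ L ∈ 𝓛, L ≠ P) (hcard : 2 ≤ P.card) :
    ∃ A ⊆ 𝓛 ×ˢ (Finset.univ : Finset Bool), 3 ≤ A.card ∧ ∀ t ∈ A, ∀ v ∈ 𝓛, ∀ p ∈ v, ∀ p' ∈ v,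
      X p < X p' → ¬ ChargesEnd 𝓛 X m v p p' t := by
  have hne : P.Nonempty := Finset.card_pos.1 (by omega)
  obtain ⟨a, ha, haP⟩ := Finset.exists_min_image P X hne
  obtain ⟨b, hb, hbP⟩ := Finset.exists_max_image P X hne
  have hab : a ≠ b := by
    rintro rfl
    obtain ⟨q, hq, hqa⟩ := Finset.exists_mem_ne (s := P) (by omega) a
    exact hqa (h.injOn q hq a ha (le_antisymm (hbP q hq) (haP q hq)))
  obtain ⟨u, hu, hau, hbu⟩ := h.isLinearSpace.exists_line a ha b hb hab
  obtain ⟨e₁, he₁, he₁min⟩ := Finset.exists_min_image (𝓛.filter fun u => a ∈ u) m ⟨u, by simp [*]⟩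
  obtain ⟨e₂, he₂, he₂min⟩ := Finset.exists_min_image (𝓛.filter fun u => b ∈ u) m ⟨u, by simp [*]⟩
  obtain ⟨e₃, he₃, he₃max⟩ := Finset.exists_max_image (𝓛.filter fun u => a ∈ u) m ⟨u, by simp [*]⟩
  obtain ⟨e₄, he₄, he₄max⟩ := Finset.exists_max_image (𝓛.filter fun u => b ∈ u) m ⟨u, by simp [*]⟩
  simp only [Finset.mem_filter, and_imp] at he₁ he₂ he₃ he₄ he₁min he₂min he₃max he₄max
  have hbelow {x : α} := h.sub_le_of_steepest he₃.1 he₃.2 haP he₃max (x := x)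
  have habove {x : α} := h.neg.sub_le_of_steepest he₄.1 he₄.2
    (fun q hq => neg_le_neg (hbP q hq)) he₄max (x := x)
  have h₁ : ∀ v ∈ 𝓛, ∀ p ∈ v, ∀ p' ∈ v, X p < X p' → ¬ ChargesEnd 𝓛 X m v p p' (e₁, false) := by
    rintro v hv p hp p' hp' hpp' (⟨hf, -⟩ | ⟨-, x, hx, hxm, h1⟩)
    · simp at hf
    · obtain rfl := h.injOn x (h.mem he₁.1 hx) a ha (le_antisymm (hxm a he₁.2)
        (haP x (h.mem he₁.1 hx)))
      exact not_charges_of_least (P := P) (X := fun p => -X p) hv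
        (fun q hq => neg_le_neg (haP q hq)) he₁min (h.mem hv hp) (neg_lt_neg hpp') h1
  have h₂ : ∀ v ∈ 𝓛, ∀ p ∈ v, ∀ p' ∈ v, X p < X p' → ¬ ChargesEnd 𝓛 X m v p p' (e₂, true) := by
    rintro v hv p hp p' hp' hpp' (⟨-, x, hx, hxm, h1⟩ | ⟨hf, -⟩)
    · obtain rfl := h.injOn x (h.mem he₂.1 hx) b hb (le_antisymm (hbP x (h.mem he₂.1 hx))
        (hxm b he₂.2))
      exact not_charges_of_least hv hbP he₂min (h.mem hv hp') hpp' h1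
    · simp at hf
  have h₃ : ∀ v ∈ 𝓛, ∀ p ∈ v, ∀ p' ∈ v, X p < X p' → ¬ ChargesEnd 𝓛 X m v p p' (e₃, true) := by
    rintro v hv p hp p' hp' hpp' (⟨-, x, hx, hxm, h1⟩ | ⟨hf, -⟩)
    · exact h.not_charges_of_le hv (hbelow hx) hp hp' hpp' h1
    · simp at hf
  have h₄ : ∀ v ∈ 𝓛, ∀ p ∈ v, ∀ p' ∈ v, X p < X p' → ¬ ChargesEnd 𝓛 X m v p p' (e₄, false) := by
    rintro v hv p hp p' hp' hpp' (⟨hf, -⟩ | ⟨-, x, hx, hxm, h1⟩)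
    · simp at hf
    · exact h.neg.not_charges_of_le hv (habove hx) hp' hp (neg_lt_neg hpp') h1
  by_cases h23 : e₂ = e₃
  · have h14 : e₁ ≠ e₄ := by
      rintro rfl
      subst h23
      have h12 := h.isLinearSpace.unique e₁ he₁.1 e₂ he₂.1 a b hab he₁.2 he₄.2 he₃.2 he₂.2
      subst h12
      refine hP e₁ he₁.1 ((h.isLinearSpace.subset e₁ he₁.1).antisymm fun q hq => ?_)
      rw [h.mem_iff e₁ he₁.1 a he₁.2 q hq]
      have h5 := hbelow he₁.2 q hq
      have h6 := habove he₁.2 q hq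
      linarith
    refine ⟨{(e₁, false), (e₂, true), (e₄, false)}, ?_, ?_, ?_⟩
    · simp [Finset.insert_subset_iff, *]
    · rw [Finset.card_eq_three.2 ⟨_, _, _, by simp, by simpa using h14, by simp, rfl⟩]
    · simp only [Finset.mem_insert, Finset.mem_singleton, forall_eq_or_imp, forall_eq]
      exact ⟨h₁, h₂, h₄⟩
  · refine ⟨{(e₁, false), (e₂, true), (e₃, true)}, ?_, ?_, ?_⟩
    · simp [Finset.insert_subset_iff, *]
    · rw [Finset.card_eq_three.2 ⟨_, _, _, by simp, by simp, by simpa using h23, rfl⟩]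
    · simp only [Finset.mem_insert, Finset.mem_singleton, forall_eq_or_imp, forall_eq]
      exact ⟨h₁, h₂, h₃⟩

/-- Melchior's inequality. -/
theorem three_le_sum (h : IsSloped P 𝓛 X Y m) (hP : ∀ L ∈ 𝓛, L ≠ P) (hcard : 2 ≤ P.card) :
    3 ≤ ∑ L ∈ 𝓛, (3 - L.card : ℤ) := by
  obtain ⟨A, hA, hA3, hAc⟩ := h.exists_uncharged hP hcard
  have hnext : ∀ v ∈ 𝓛, ∀ p ∈ v, (∃ q ∈ v, X p < X q) →
      ∃ p' ∈ v, X p < X p' ∧ ∀ r ∈ v, X p < X r → X p' ≤ X r := by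
    rintro v - p - ⟨q, hq, hpq⟩
    obtain ⟨p', hp', hmin⟩ := Finset.exists_min_image (v.filter fun q => X p < X q) X
      ⟨q, by simp [*]⟩
    simp only [Finset.mem_filter, and_imp] at hp' hmin
    exact ⟨p', hp'.1, hp'.2, hmin⟩
  choose! nxt hnv hnlt hnle using hnext
  let C : Finset (Σ _ : Finset α, α) := 𝓛.sigma fun v => v.filter fun p => ∃ q ∈ v, X p < X q
  have hC : ∀ z ∈ C, z.1 ∈ 𝓛 ∧ z.2 ∈ z.1 ∧ ∃ q ∈ z.1, X z.2 < X q := by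
    intro z hz
    simpa [C] using hz
  choose! f hf hfc using fun (z : Σ _ : Finset α, α) (hz : z ∈ C) =>
    h.exists_chargesEnd (hC z hz).1 (hP _ (hC z hz).1) (hC z hz).2.1
      (hnv z.1 (hC z hz).1 z.2 (hC z hz).2.1 (hC z hz).2.2)
      (hnlt z.1 (hC z hz).1 z.2 (hC z hz).2.1 (hC z hz).2.2)
  have hcC : C.card ≤ ((𝓛 ×ˢ (Finset.univ : Finset Bool)) \ A).card := by
    refine Finset.card_le_card_of_injOn f (fun z hz => ?_) ?_
    · refine Finset.mem_sdiff.2 ⟨Finset.mem_product.2 ⟨hf z hz, Finset.mem_univ _⟩, fun hzA => ?_⟩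
      obtain ⟨h1, h2, h3⟩ := hC z hz
      exact hAc _ hzA z.1 h1 z.2 h2 _ (hnv _ h1 _ h2 h3) (hnlt _ h1 _ h2 h3) (hfc z hz)
    · rintro ⟨v, p⟩ hz ⟨v', q⟩ hz' hfe
      have h1 := hfc _ hz
      have h2 := hfc _ hz'
      rw [hfe] at h1
      obtain ⟨hv, hp, hpn⟩ := hC _ hz
      obtain ⟨hv', hq, hqn⟩ := hC _ hz'
      obtain ⟨h3, h4⟩ := h.chargesEnd_unique hv hv' (hf _ hz') h1 h2
      dsimp only at *
      subst h3
      have hpq : p = q := by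
        rcases h4 with h4 | h4
        · refine h.injOn p (h.mem hv hp) q (h.mem hv hq) (le_antisymm ?_ ?_)
          · by_contra! hlt
            have h5 := hnle v hv q hq hqn p hp hlt
            have h6 := hnlt v hv p hp hpn
            rw [h4] at h6
            linarith
          · by_contra! hlt
            have h5 := hnle v hv p hp hpn q hq hlt
            have h6 := hnlt v hv q hq hqn
            rw [← h4] at h6
            linarith
        · exact h4
      rw [hpq]
  have hsum : C.card = ∑ L ∈ 𝓛, (L.card - 1) := by
    rw [Finset.card_sigma]
    refine Finset.sum_congr rfl fun v hv => ?_
    have h2 := h.isLinearSpace.two_le v hv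
    obtain ⟨x, hx, hxm⟩ := Finset.exists_max_image v X (Finset.card_pos.1 (by omega))
    rw [← Finset.card_erase_of_mem hx]
    congr 1
    ext p
    simp only [Finset.mem_filter, Finset.mem_erase]
    refine ⟨?_, ?_⟩
    · rintro ⟨hp, q, hq, hpq⟩
      refine ⟨?_, hp⟩
      rintro rfl
      linarith [hxm q hq]
    · rintro ⟨hpx, hp⟩
      exact ⟨hp, x, hx, lt_of_le_of_ne (hxm p hp)
        fun heq => hpx (h.injOn p (h.mem hv hp) x (h.mem hv hx) heq)⟩
  rw [Finset.card_sdiff_of_subset hA, Finset.card_product, Finset.card_univ, Fintype.card_bool]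
    at hcC
  have hA' := Finset.card_le_card hA
  rw [Finset.card_product, Finset.card_univ, Fintype.card_bool] at hA'
  have hcast : ∑ L ∈ 𝓛, (3 - L.card : ℤ) = 2 * 𝓛.card - C.card := by
    rw [hsum, Nat.cast_sum, Finset.card_eq_sum_ones, Nat.cast_sum, Finset.mul_sum,
      ← Finset.sum_sub_distrib]
    refine Finset.sum_congr rfl fun L hL => ?_
    have h2 := h.isLinearSpace.two_le L hL
    push_cast [show 1 ≤ L.card by omega]
    ring
  rw [hcast]
  omega

end IsSloped

end Melchior

section PlaneLines

variable {P R B : Finset (ℝ × ℝ)}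

@[simp] lemma cross_self_left (p q : ℝ × ℝ) : cross p q p = 0 := by simp [cross]

@[simp] lemma cross_self_right (p q : ℝ × ℝ) : cross p q q = 0 := by simp [cross, mul_comm]

lemma cross_eq_zero_iff {p q x y : ℝ × ℝ} (hpq : p ≠ q) (hxy : x ≠ y) (hx : cross p q x = 0)
    (hy : cross p q y = 0) (z : ℝ × ℝ) : cross p q z = 0 ↔ cross x y z = 0 := by
  have e1 : (q.1 - p.1) * cross x y z = (y.1 - x.1) * cross p q z := by
    simp only [cross] at *; linear_combination (x.1 - z.1) * hy + (z.1 - y.1) * hx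
  have e2 : (q.2 - p.2) * cross x y z = (y.2 - x.2) * cross p q z := by
    simp only [cross] at *; linear_combination (x.2 - z.2) * hy + (z.2 - y.2) * hx
  constructor
  · intro h
    rw [h, mul_zero] at e1 e2
    by_contra hc
    have h1 := (mul_eq_zero.1 e1).resolve_right hc
    have h2 := (mul_eq_zero.1 e2).resolve_right hc
    exact hpq (Prod.ext (by linarith) (by linarith))
  · intro h
    rw [h, mul_zero] at e1 e2
    by_contra hc
    have h1 := (mul_eq_zero.1 e1.symm).resolve_right hc
    have h2 := (mul_eq_zero.1 e2.symm).resolve_right hc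
    exact hxy (Prod.ext (by linarith) (by linarith))

lemma mem_affineSpan_iff_cross {p q : ℝ × ℝ} (hpq : p ≠ q) (z : ℝ × ℝ) :
    z ∈ (affineSpan ℝ ({p, q} : Set (ℝ × ℝ)) : Set (ℝ × ℝ)) ↔ cross p q z = 0 := by
  rw [SetLike.mem_coe, mem_affineSpan_pair_iff_exists_lineMap_eq]
  constructor
  · rintro ⟨r, rfl⟩
    simp [cross, AffineMap.lineMap_apply]
    ring
  · intro h
    simp only [cross] at h
    by_cases h1 : q.1 - p.1 = 0
    · have h2 : q.2 - p.2 ≠ 0 := fun h2 => hpq (Prod.ext (by linarith) (by linarith))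
      rw [h1, zero_mul, zero_sub, neg_eq_zero] at h
      have h3 := (mul_eq_zero.1 h).resolve_left h2
      refine ⟨(z.2 - p.2) / (q.2 - p.2), Prod.ext ?_ ?_⟩
      · simp [AffineMap.lineMap_apply, h1]; linarith
      · simp [AffineMap.lineMap_apply, h2]
    · refine ⟨(z.1 - p.1) / (q.1 - p.1), Prod.ext ?_ ?_⟩
      · simp [AffineMap.lineMap_apply, h1]
      · simp [AffineMap.lineMap_apply]
        field_simp
        linarith

/-- The traces on `P` of the lines determined by `P`. -/
def lineTraces (P : Finset (ℝ × ℝ)) : Finset (Finset (ℝ × ℝ)) :=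
  P.offDiag.image fun x => P.filter fun z => cross x.1 x.2 z = 0

lemma mem_lineTraces {L : Finset (ℝ × ℝ)} : L ∈ lineTraces P ↔
    ∃ p ∈ P, ∃ q ∈ P, p ≠ q ∧ L = P.filter fun z => cross p q z = 0 := by
  simp only [lineTraces, Finset.mem_image, Finset.mem_offDiag]
  constructor
  · rintro ⟨⟨p, q⟩, ⟨hp, hq, hpq⟩, rfl⟩; exact ⟨p, hp, q, hq, hpq, rfl⟩
  · rintro ⟨p, hp, q, hq, hpq, rfl⟩; exact ⟨(p, q), ⟨hp, hq, hpq⟩, rfl⟩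

lemma eq_filter_of_mem_lineTraces {L : Finset (ℝ × ℝ)} (hL : L ∈ lineTraces P) {x y : ℝ × ℝ}
    (hx : x ∈ L) (hy : y ∈ L) (hxy : x ≠ y) : L = P.filter fun z => cross x y z = 0 := by
  obtain ⟨p, hp, q, hq, hpq, rfl⟩ := mem_lineTraces.1 hL
  rw [Finset.mem_filter] at hx hy
  exact Finset.filter_congr fun z _ => cross_eq_zero_iff hpq hxy hx.2 hy.2 z

lemma exists_mem_lineTraces {p q : ℝ × ℝ} (hp : p ∈ P) (hq : q ∈ P) (hpq : p ≠ q) :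
    ∃ L ∈ lineTraces P, p ∈ L ∧ q ∈ L :=
  ⟨_, mem_lineTraces.2 ⟨p, hp, q, hq, hpq, rfl⟩, by simp [hp], by simp [hq]⟩

lemma isLinearSpace_lineTraces (P : Finset (ℝ × ℝ)) : IsLinearSpace P (lineTraces P) where
  subset L hL := by
    obtain ⟨p, hp, q, hq, hpq, rfl⟩ := mem_lineTraces.1 hL
    exact Finset.filter_subset _ _
  two_le L hL := by
    obtain ⟨p, hp, q, hq, hpq, rfl⟩ := mem_lineTraces.1 hL
    exact Finset.one_lt_card.2 ⟨p, by simp [hp], q, by simp [hq], hpq⟩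
  exists_line p hp q hq hpq := exists_mem_lineTraces hp hq hpq
  unique L hL M hM p q hpq hpL hqL hpM hqM := by
    rw [eq_filter_of_mem_lineTraces hL hpL hqL hpq, eq_filter_of_mem_lineTraces hM hpM hqM hpq]

lemma Coll.cross_eq_zero {x y z : ℝ × ℝ} (h : Coll (lineTraces P) x y z) : cross x y z = 0 := by
  obtain ⟨L, hL, hx, hy, hz⟩ := h
  by_cases hxy : x = y
  · subst hxy; simp [cross]
  · rw [eq_filter_of_mem_lineTraces hL hx hy hxy, Finset.mem_filter] at hz
    exact hz.2

lemma coll_of_cross_eq_zero {x y z : ℝ × ℝ} (hx : x ∈ P) (hy : y ∈ P) (hz : z ∈ P)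
    (h : cross x y z = 0) (hL : ∃ L ∈ lineTraces P, x ∈ L) : Coll (lineTraces P) x y z := by
  by_cases hxy : x = y
  · subst hxy
    by_cases hxz : x = z
    · subst hxz
      obtain ⟨L, hL, hxL⟩ := hL
      exact ⟨L, hL, hxL, hxL, hxL⟩
    · obtain ⟨L, hL, hxL, hzL⟩ := exists_mem_lineTraces hx hz hxz
      exact ⟨L, hL, hxL, hxL, hzL⟩
  · exact ⟨_, mem_lineTraces.2 ⟨x, hx, y, hy, hxy, rfl⟩, by simp [hx], by simp [hy], by simp [*]⟩

lemma not_isCritical_lineTraces : ¬ IsCritical P R B (lineTraces P) := by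
  intro h
  obtain ⟨p, hp, q, hq, s, hs, b, d, c, u, v, hn, hbp, hbq, hdp, hus, h1, h2, h3, h4, h5, h6, h7,
    h8⟩ := h.exists_macLane
  obtain ⟨L, hL, hpL, -⟩ := id h1
  exact false_of_macLane (fun h0 => hn (coll_of_cross_eq_zero hp hq hs h0 ⟨L, hL, hpL⟩))
    hbp hbq hdp hus h1.cross_eq_zero h2.cross_eq_zero h3.cross_eq_zero h4.cross_eq_zero
    h5.cross_eq_zero h6.cross_eq_zero h7.cross_eq_zero h8.cross_eq_zero

lemma exists_shear_injOn (P : Finset (ℝ × ℝ)) :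
    ∃ ε : ℝ, ∀ p ∈ P, ∀ q ∈ P, p.1 + ε * p.2 = q.1 + ε * q.2 → p = q := by
  obtain ⟨ε, hε⟩ := Infinite.exists_notMem_finset
    ((P ×ˢ P).image fun x => -(x.1.1 - x.2.1) / (x.1.2 - x.2.2))
  refine ⟨ε, fun p hp q hq h => ?_⟩
  by_cases h2 : p.2 - q.2 = 0
  · refine Prod.ext ?_ (by linarith)
    rw [sub_eq_zero.1 h2] at h
    linarith
  · refine absurd (Finset.mem_image.2 ⟨(p, q), Finset.mk_mem_product hp hq, ?_⟩) hε
    dsimp only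
    field_simp
    linarith

lemma exists_isSloped_lineTraces (P : Finset (ℝ × ℝ)) :
    ∃ X Y m, IsSloped P (lineTraces P) X Y m := by
  obtain ⟨ε, hε⟩ := exists_shear_injOn P
  have hslope : ∀ L ∈ lineTraces P, ∃ m : ℝ, ∀ p ∈ L, ∀ q ∈ P,
      q ∈ L ↔ q.2 - p.2 = m * ((q.1 + ε * q.2) - (p.1 + ε * p.2)) := by
    intro L hL
    obtain ⟨a, ha, b, hb, hab, rfl⟩ := mem_lineTraces.1 hL
    have hX : (b.1 + ε * b.2) - (a.1 + ε * a.2) ≠ 0 :=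
      fun h => hab (hε a ha b hb (by linarith))
    refine ⟨(b.2 - a.2) / ((b.1 + ε * b.2) - (a.1 + ε * a.2)), fun p hp q hq => ?_⟩
    rw [Finset.mem_filter] at hp
    have hp := hp.2
    simp only [Finset.mem_filter, hq, true_and]
    rw [div_mul_eq_mul_div, eq_div_iff hX]
    simp only [cross] at *
    exact ⟨fun h => by linear_combination h - hp, fun h => by linear_combination h + hp⟩
  choose! m hm using hslope
  exact ⟨fun p => p.1 + ε * p.2, Prod.snd, m, isLinearSpace_lineTraces P, hε, hm⟩

lemma mem_lineTraces_of_erase {p : ℝ × ℝ} {M : Finset (ℝ × ℝ)} (hM : M ∈ lineTraces (P.erase p)) :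
    ∃ L ∈ lineTraces P, M = L.erase p := by
  obtain ⟨a, ha, b, hb, hab, rfl⟩ := mem_lineTraces.1 hM
  exact ⟨_, mem_lineTraces.2 ⟨a, Finset.mem_of_mem_erase ha, b, Finset.mem_of_mem_erase hb, hab,
    rfl⟩, Finset.filter_erase _ _ _⟩

lemma card_bichromaticMembers_erase_le (R B : Finset (ℝ × ℝ)) (p : ℝ × ℝ) :
    (bichromaticMembers (lineTraces ((R ∪ B).erase p)) (R.erase p) (B.erase p)).card ≤
      ((bichromaticMembers (lineTraces (R ∪ B)) R B).filter fun L =>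
        ((L ∩ R).erase p).Nonempty ∧ ((L ∩ B).erase p).Nonempty).card := by
  refine (Finset.card_le_card fun M hM => ?_).trans
    (Finset.card_image_le (f := fun L : Finset (ℝ × ℝ) => L.erase p))
  obtain ⟨hM, hMR, hMB⟩ := mem_bichromaticMembers.1 hM
  obtain ⟨L, hL, rfl⟩ := mem_lineTraces_of_erase hM
  have hsub (A : Finset (ℝ × ℝ)) : L.erase p ∩ A.erase p = (L ∩ A).erase p := by
    ext; simp only [Finset.mem_inter, Finset.mem_erase]; tauto
  rw [hsub] at hMR hMB
  exact Finset.mem_image.2 ⟨L, Finset.mem_filter.2 ⟨mem_bichromaticMembers.2 ⟨hL,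
    hMR.mono (Finset.erase_subset _ _), hMB.mono (Finset.erase_subset _ _)⟩, hMR, hMB⟩, rfl⟩

lemma card_sub_one_le_card_bichromaticMembers (N : ℕ) : ∀ R B : Finset (ℝ × ℝ), Disjoint R B →
    (B.card = R.card ∨ B.card + 1 = R.card) → (R ∪ B).card = N →
    (∀ L ∈ lineTraces (R ∪ B), L.card + 2 ≤ N) →
    N - 1 ≤ (bichromaticMembers (lineTraces (R ∪ B)) R B).card := by
  induction N with
  | zero => intros; omega
  | succ N ih =>
    intro R B hRB hbal hN hle
    have hlin := isLinearSpace_lineTraces (R ∪ B)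
    rcases Nat.eq_zero_or_pos N with rfl | hNpos
    · omega
    obtain ⟨a, ha, b, hb, hab⟩ := Finset.one_lt_card.1 (show 1 < (R ∪ B).card by omega)
    obtain ⟨L₀, hL₀, -⟩ := exists_mem_lineTraces ha hb hab
    have h4 : 4 ≤ N + 1 := by
      have := hle L₀ hL₀
      have := hlin.two_le L₀ hL₀
      omega
    by_contra! hlt
    have hle3 : ∀ L ∈ lineTraces (R ∪ B), L.card + 3 ≤ (R ∪ B).card := by
      intro L hL
      have h1 := hle L hL
      by_contra! h2
      have := hlin.card_sub_one_le_of_card_add_two rfl hRB hbal hL (by omega) (by omega)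
      omega
    have hcard := Finset.card_union_of_disjoint hRB
    have hstep : ∀ p ∈ R ∪ B, ((B.erase p).card = (R.erase p).card ∨
        (B.erase p).card + 1 = (R.erase p).card ∨ (R.erase p).card + 1 = (B.erase p).card) →
        (bichromaticMembers (lineTraces (R ∪ B)) R B).card + 2 = (R ∪ B).card ∧
          ∀ L ∈ bichromaticMembers (lineTraces (R ∪ B)) R B,
            ((L ∩ R).erase p).Nonempty ∧ ((L ∩ B).erase p).Nonempty := by
      intro p hp hbalp
      have hunion : R.erase p ∪ B.erase p = (R ∪ B).erase p :=
        (Finset.erase_union_distrib R B p).symm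
      have hdisj : Disjoint (R.erase p) (B.erase p) :=
        hRB.mono (Finset.erase_subset _ _) (Finset.erase_subset _ _)
      have hcp : ((R ∪ B).erase p).card = N := by
        rw [Finset.card_erase_of_mem hp, hN, Nat.add_sub_cancel]
      have hlep : ∀ L ∈ lineTraces ((R ∪ B).erase p), L.card + 2 ≤ N := by
        intro M hM
        obtain ⟨L, hL, rfl⟩ := mem_lineTraces_of_erase hM
        have := hle3 L hL
        have := Finset.card_erase_le (s := L) (a := p)
        omega
      have hge : N - 1 ≤ (bichromaticMembers (lineTraces ((R ∪ B).erase p)) (R.erase p)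
          (B.erase p)).card := by
        rcases or_assoc.2 hbalp with h1 | h1
        · have := ih _ _ hdisj h1 (by rw [hunion, hcp]) (by rwa [hunion])
          rwa [hunion] at this
        · have := ih _ _ hdisj.symm (Or.inr h1) (by rw [Finset.union_comm, hunion, hcp])
            (by rwa [Finset.union_comm, hunion])
          rwa [Finset.union_comm, hunion, bichromaticMembers_comm] at this
      have h1 := hge.trans (card_bichromaticMembers_erase_le R B p)
      have h2 := Finset.card_filter_le (bichromaticMembers (lineTraces (R ∪ B)) R B) fun L =>
        ((L ∩ R).erase p).Nonempty ∧ ((L ∩ B).erase p).Nonempty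
      exact ⟨by omega, Finset.card_filter_eq_iff.1 (by omega)⟩
    have hred := fun p hp => hstep p (Finset.mem_union_left B hp) (by
      rw [Finset.card_erase_of_mem hp,
        Finset.erase_eq_of_notMem (Finset.disjoint_left.1 hRB hp)]
      have := Finset.card_pos.2 ⟨p, hp⟩
      omega)
    have htwo {A L : Finset (ℝ × ℝ)} (hA : (L ∩ A).Nonempty)
        (h : ∀ p ∈ A, ((L ∩ A).erase p).Nonempty) : 2 ≤ (L ∩ A).card := by
      obtain ⟨p, hp⟩ := hA
      have h1 := Finset.card_pos.2 (h p (Finset.mem_inter.1 hp).2)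
      rw [Finset.card_erase_of_mem hp] at h1
      omega
    obtain ⟨r, hr⟩ : R.Nonempty := Finset.card_pos.1 (by omega)
    obtain ⟨X, Y, m, hslope⟩ := exists_isSloped_lineTraces (R ∪ B)
    refine not_isCritical_lineTraces (P := R ∪ B) (R := R) (B := B) ⟨hlin, rfl, hRB, hbal,
      hslope.three_le_sum ?_ (by omega), hle3, (hred r hr).1, ?_, ?_⟩
    · rintro L hL rfl
      have := hle _ hL
      omega
    · exact fun L hL => htwo (mem_bichromaticMembers.1 hL).2.1 fun p hp => ((hred p hp).2 L hL).1
    · intro heq L hL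
      refine htwo (mem_bichromaticMembers.1 hL).2.2 fun p hp =>
        ((hstep p (Finset.mem_union_right R hp) ?_).2 L hL).2
      rw [Finset.card_erase_of_mem hp,
        Finset.erase_eq_of_notMem (Finset.disjoint_right.1 hRB hp)]
      have := Finset.card_pos.2 ⟨p, hp⟩
      omega

lemma IsLine.ptsOn_mem_lineTraces {L : Set (ℝ × ℝ)} (hL : IsLine L) (h2 : 2 ≤ (ptsOn P L).card) :
    ptsOn P L ∈ lineTraces P := by
  obtain ⟨p, q, hpq, rfl⟩ := hL
  obtain ⟨x, hx, y, hy, hxy⟩ := Finset.one_lt_card.1 h2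
  simp only [ptsOn, Finset.mem_filter, mem_affineSpan_iff_cross hpq] at hx hy
  refine mem_lineTraces.2 ⟨x, hx.1, y, hy.1, hxy, Finset.filter_congr fun z _ => ?_⟩
  rw [mem_affineSpan_iff_cross hpq, cross_eq_zero_iff hpq hxy hx.2 hy.2]

lemma exists_isLine_of_mem_lineTraces {M : Finset (ℝ × ℝ)} (hM : M ∈ lineTraces P) :
    ∃ L, IsLine L ∧ ptsOn P L = M := by
  obtain ⟨p, hp, q, hq, hpq, rfl⟩ := mem_lineTraces.1 hM
  exact ⟨_, ⟨p, q, hpq, rfl⟩, Finset.filter_congr fun z _ => mem_affineSpan_iff_cross hpq z⟩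

lemma IsLine.eq_of_mem {L : Set (ℝ × ℝ)} (hL : IsLine L) {x y : ℝ × ℝ} (hxy : x ≠ y)
    (hx : x ∈ L) (hy : y ∈ L) : L = {z | cross x y z = 0} := by
  obtain ⟨p, q, hpq, rfl⟩ := hL
  rw [mem_affineSpan_iff_cross hpq] at hx hy
  ext z
  rw [mem_affineSpan_iff_cross hpq, cross_eq_zero_iff hpq hxy hx hy]
  rfl

lemma IsLine.collinear {L : Set (ℝ × ℝ)} (hL : IsLine L) : Collinear ℝ L := by
  obtain ⟨p, q, -, rfl⟩ := hL
  rw [Collinear, ← AffineSubspace.direction_eq_vectorSpan, direction_affineSpan]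
  exact collinear_pair ℝ p q

lemma card_bichromaticMembers_lineTraces (R B : Finset (ℝ × ℝ)) :
    (bichromaticMembers (lineTraces (R ∪ B)) R B).card = nBichromatic R B := by
  rw [nBichromatic, ← Set.ncard_coe_finset]
  have himg : (bichromaticMembers (lineTraces (R ∪ B)) R B : Set (Finset (ℝ × ℝ))) =
      ptsOn (R ∪ B) '' {L | BichromaticLine R B L} := by
    ext M
    simp only [Finset.mem_coe, mem_bichromaticMembers, Set.mem_image, Set.mem_ofPred_eq]
    constructor
    · rintro ⟨hM, ⟨x, hx⟩, ⟨y, hy⟩⟩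
      obtain ⟨L, hL, rfl⟩ := exists_isLine_of_mem_lineTraces hM
      simp only [ptsOn, Finset.mem_inter, Finset.mem_filter] at hx hy
      exact ⟨L, ⟨⟨hL, (isLinearSpace_lineTraces _).two_le _ hM⟩, ⟨x, hx.2, hx.1.2⟩,
        ⟨y, hy.2, hy.1.2⟩⟩, rfl⟩
    · rintro ⟨L, ⟨⟨hL, h2⟩, ⟨x, hxR, hx⟩, ⟨y, hyB, hy⟩⟩, rfl⟩
      exact ⟨hL.ptsOn_mem_lineTraces h2, ⟨x, by simp [ptsOn, *]⟩, ⟨y, by simp [ptsOn, *]⟩⟩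
  rw [himg]
  refine Set.InjOn.ncard_image ?_
  rintro L ⟨⟨hL, h2⟩, -⟩ M ⟨⟨hM, -⟩, -⟩ hLM
  obtain ⟨x, hx, y, hy, hxy⟩ := Finset.one_lt_card.1 h2
  have hx' := hx
  have hy' := hy
  rw [hLM] at hx' hy'
  simp only [ptsOn, Finset.mem_filter] at hx hy hx' hy'
  rw [hL.eq_of_mem hxy hx.2 hy.2, hM.eq_of_mem hxy hx'.2 hy'.2]

lemma card_add_two_le_of_mem_lineTraces (hcol : ¬ Collinear ℝ (P : Set (ℝ × ℝ)))
    (hnp : ¬ NearPencil P) {M : Finset (ℝ × ℝ)} (hM : M ∈ lineTraces P) : M.card + 2 ≤ P.card := by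
  obtain ⟨L, hL, rfl⟩ := exists_isLine_of_mem_lineTraces hM
  have h1 : ptsOn P L ⊆ P := Finset.filter_subset _ _
  have h2 : (ptsOn P L).card ≠ P.card := fun h => hcol (hL.collinear.subset fun x hx =>
    (Finset.mem_filter.1 (Finset.eq_of_subset_of_card_le h1 h.ge ▸ hx)).2)
  have h3 : (ptsOn P L).card ≠ P.card - 1 := fun h => hnp ⟨L, hL, h⟩
  have h4 := Finset.card_le_card h1
  omega

end PlaneLines

/-- **Theorem (main theorem).** If `P = R ∪ B` with `|R| = n`, `|B| ∈ {n, n-1}`,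
and `P` is neither collinear nor a near-pencil, then `P` determines at least
`|P| - 1` bichromatic lines. -/
theorem bichromatic_lines_of_not_collinear_not_nearPencil
    (n : ℕ) (hn : 1 ≤ n) (R B : Finset (ℝ × ℝ)) (hRB : Disjoint R B)
    (hR : R.card = n) (hB : B.card = n ∨ B.card = n - 1)
    (hcol : ¬ Collinear ℝ ((R ∪ B : Finset (ℝ × ℝ)) : Set (ℝ × ℝ)))
    (hnp : ¬ NearPencil (R ∪ B)) :
    (R ∪ B).card - 1 ≤ nBichromatic R B := by
  rw [← card_bichromaticMembers_lineTraces]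
  exact card_sub_one_le_card_bichromaticMembers _ R B hRB (by omega) rfl
    fun L hL => card_add_two_le_of_mem_lineTraces hcol hnp hL
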